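/- arXiv:2006.06250 — 4 statements merged into one kernel-verified Lean document; each statement's English description precedes it below -/
import Mathlib

section
/- Let n ≥ 1, let G be a real symmetric positive definite n×n matrix and let ξ be an n×n complex symmetric matrix. Then the matrix M := ξ·G·ξ̄·G is diagonalizable over ℂ with all eigenvalues real and nonnegative; that is, there exist an invertible complex n×n matrix Q and a real diagonal n×n matrix Δ with nonnegative diagonal entries such that M = Q·Δ·Q⁻¹. -/
open scoped ComplexOrder

/-- For `G` a real symmetric positive definite `n×n` matrix and `ξ` an `n×n`
complex symmetric matrix, the matrix `M = ξ·G·ξ̄·G` is diagonalizable over `ℂ` with all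
eigenvalues real and nonnegative. -/
theorem statement0 (n : ℕ) (hn : 1 ≤ n)
    (G : Matrix (Fin n) (Fin n) ℝ) (hGsym : G.IsSymm) (hGpd : G.PosDef)
    (ξ : Matrix (Fin n) (Fin n) ℂ) (hξsym : ξ.IsSymm) :
    ∃ (Q : Matrix (Fin n) (Fin n) ℂ) (d : Fin n → ℝ),
      IsUnit Q.det ∧ (∀ i, 0 ≤ d i) ∧
      ξ * G.map Complex.ofReal * ξ.map (starRingEnd ℂ) * G.map Complex.ofReal =
        Q * Matrix.diagonal (fun i => (d i : ℂ)) * Q⁻¹ := by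
  obtain ⟨S, hS⟩ : ∃ S : Matrix (Fin n) (Fin n) ℝ, G = S.conjTranspose * S := by
    open scoped MatrixOrder Matrix.Norms.L2Operator in
    exact CStarAlgebra.nonneg_iff_eq_star_mul_self.mp hGpd.posSemidef.nonneg
  have hSdet : S.det ≠ 0 := by
    intro h
    have := hGpd.det_pos
    rw [hS, Matrix.det_mul, h, mul_zero] at this
    exact lt_irrefl _ this
  obtain ⟨T, hT⟩ : ∃ T : Matrix (Fin n) (Fin n) ℂ, T = S.map Complex.ofReal := ⟨_, rfl⟩
  have hTdet : IsUnit T.det := by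
    have h : T.det = ((S.det : ℝ) : ℂ) := by
      rw [hT]
      exact (RingHom.map_det Complex.ofRealHom S).symm
    rw [h, isUnit_iff_ne_zero]
    exact_mod_cast hSdet
  have hGT : G.map Complex.ofReal = T.conjTranspose * T := by
    rw [hS, hT]
    ext i j
    simp [Matrix.mul_apply]
  have hξ : ξ.map (starRingEnd ℂ) = ξ.conjTranspose := by
    ext i j
    simp [Matrix.conjTranspose_apply, hξsym.apply i j]
  obtain ⟨A, hA⟩ : ∃ A : Matrix (Fin n) (Fin n) ℂ, A = T * ξ * T.conjTranspose := ⟨_, rfl⟩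
  have hP : (A * A.conjTranspose).PosSemidef := Matrix.posSemidef_self_mul_conjTranspose A
  have hsp := hP.1.spectral_theorem
  rw [Unitary.conjStarAlgAut_apply] at hsp
  have hU1 := Unitary.coe_star_mul_self hP.1.eigenvectorUnitary
  have hU2 := Unitary.coe_mul_star_self hP.1.eigenvectorUnitary
  set U : Matrix (Fin n) (Fin n) ℂ := (hP.1.eigenvectorUnitary : Matrix (Fin n) (Fin n) ℂ) with hU
  have hTT : T⁻¹ * T = 1 := Matrix.nonsing_inv_mul T hTdet
  have hTT' : T * T⁻¹ = 1 := Matrix.mul_nonsing_inv T hTdet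
  have hQ : (T⁻¹ * U) * (star U * T) = 1 := by
    calc (T⁻¹ * U) * (star U * T) = T⁻¹ * (U * star U) * T := by simp only [Matrix.mul_assoc]
      _ = 1 := by rw [show U * star U = 1 from hU2, Matrix.mul_one, hTT]
  refine ⟨T⁻¹ * U, hP.1.eigenvalues, Matrix.isUnit_det_of_right_inverse hQ,
    hP.eigenvalues_nonneg, ?_⟩
  rw [Matrix.inv_eq_right_inv hQ, hGT, hξ]
  calc ξ * (T.conjTranspose * T) * ξ.conjTranspose * (T.conjTranspose * T)
      = (T⁻¹ * T) * (ξ * (T.conjTranspose * T) * ξ.conjTranspose * (T.conjTranspose * T)) := by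
        rw [hTT, Matrix.one_mul]
    _ = T⁻¹ * (A * A.conjTranspose) * T := by
        rw [hA]
        simp only [Matrix.conjTranspose_mul, Matrix.conjTranspose_conjTranspose, Matrix.mul_assoc]
    _ = T⁻¹ * (U * Matrix.diagonal (fun i => (hP.1.eigenvalues i : ℂ)) * star U) * T :=
        congrArg (fun X => T⁻¹ * X * T) hsp
    _ = _ := by simp only [Matrix.mul_assoc]
end

section
/- Let n ≥ 1, let G be a real symmetric positive definite n×n matrix and ξ an n×n complex symmetric matrix, and set M := ξ·G·ξ̄·G. Assume that the spectral radius of M is strictly less than 1. Then there exists a unique complex n×n matrix S such that S² = 𝟙 − M and S is diagonalizable with all eigenvalues real and strictly positive; moreover the eigenvalues of S lie in the interval (0,1]. -/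
/-- A complex matrix is diagonalizable with all eigenvalues real and strictly positive. -/
def DiagonalizablePosReal {n : ℕ} (S : Matrix (Fin n) (Fin n) ℂ) : Prop :=
  ∃ (Q : Matrix (Fin n) (Fin n) ℂ) (d : Fin n → ℝ),
    IsUnit Q.det ∧ (∀ i, 0 < d i) ∧
    S = Q * Matrix.diagonal (fun i => (d i : ℂ)) * Q⁻¹

open Matrix in
open scoped MatrixOrder in
lemma aux_real_factor {n : ℕ} (G : Matrix (Fin n) (Fin n) ℝ) (hG : G.PosDef) :
    ∃ R : Matrix (Fin n) (Fin n) ℝ, IsUnit R.det ∧ G = Rᵀ * R := by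
  obtain ⟨B, hB⟩ := CStarAlgebra.nonneg_iff_eq_star_mul_self.mp hG.posSemidef.nonneg
  have hB' : G = Bᵀ * B := by
    rw [hB, star_eq_conjTranspose, conjTranspose_eq_transpose_of_trivial]
  refine ⟨B, ?_, hB'⟩
  have h := hG.det_pos
  rw [hB', det_mul, det_transpose] at h
  rw [isUnit_iff_ne_zero]
  intro h0
  simp [h0] at h

open Matrix in
open scoped ComplexOrder in
lemma aux_diag {n : ℕ} (A : Matrix (Fin n) (Fin n) ℂ) (hA : A.PosSemidef) :
    ∃ (Q : Matrix (Fin n) (Fin n) ℂ) (d : Fin n → ℝ),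
    IsUnit Q.det ∧ (∀ i, 0 ≤ d i) ∧
    A = Q * Matrix.diagonal (fun i => (d i : ℂ)) * Q⁻¹ := by
  have hU : (hA.1.eigenvectorUnitary : Matrix (Fin n) (Fin n) ℂ)
      * star (hA.1.eigenvectorUnitary : Matrix (Fin n) (Fin n) ℂ) = 1 :=
    Unitary.mul_star_self_of_mem hA.1.eigenvectorUnitary.2
  refine ⟨hA.1.eigenvectorUnitary, hA.1.eigenvalues, ?_, hA.eigenvalues_nonneg, ?_⟩
  · exact isUnit_det_of_right_inverse hU
  · rw [inv_eq_right_inv hU]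
    conv_lhs => rw [hA.1.spectral_theorem, Unitary.conjStarAlgAut_apply]
    rfl

open Matrix in
open scoped ComplexOrder in
lemma aux_M {n : ℕ} (G : Matrix (Fin n) (Fin n) ℝ) (hGpd : G.PosDef)
    (ξ : Matrix (Fin n) (Fin n) ℂ) (hξsym : ξ.IsSymm) :
    ∃ (Q : Matrix (Fin n) (Fin n) ℂ) (d : Fin n → ℝ),
    IsUnit Q.det ∧ (∀ i, 0 ≤ d i) ∧
    ξ * G.map Complex.ofReal * ξ.map (starRingEnd ℂ) * G.map Complex.ofReal
      = Q * Matrix.diagonal (fun i => (d i : ℂ)) * Q⁻¹ := by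
  obtain ⟨R, hR, hG⟩ := aux_real_factor G hGpd
  set P : Matrix (Fin n) (Fin n) ℂ := R.map Complex.ofReal with hP
  have hGP : G.map Complex.ofReal = Pᵀ * P := by
    rw [hG, hP, ← transpose_map]
    exact Matrix.map_mul (f := Complex.ofRealHom)
  have hPdet : IsUnit P.det := by
    have : P.det = Complex.ofRealHom R.det := by
      rw [RingHom.map_det]; rfl
    rw [this]
    exact hR.map _
  have hPT : Pᵀᴴ = P := by
    ext i j; simp [hP]
  have hPH : Pᴴ = Pᵀ := by
    ext i j; simp [hP]
  have hξ : ξᴴ = ξ.map (starRingEnd ℂ) := by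
    rw [conjTranspose, hξsym.eq]; rfl
  obtain ⟨U, d, hU, hd, hA⟩ := aux_diag ((P * ξ * Pᵀ) * (P * ξ * Pᵀ)ᴴ)
    (posSemidef_self_mul_conjTranspose _)
  refine ⟨P⁻¹ * U, d, ?_, hd, ?_⟩
  · rw [det_mul]
    exact (P.isUnit_nonsing_inv_det hPdet).mul hU
  · rw [Matrix.mul_inv_rev, nonsing_inv_nonsing_inv P hPdet]
    have h1 : P⁻¹ * U * diagonal (fun i => (d i : ℂ)) * (U⁻¹ * P)
        = P⁻¹ * (U * diagonal (fun i => (d i : ℂ)) * U⁻¹) * P := by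
      simp only [Matrix.mul_assoc]
    rw [h1, ← hA, hGP, conjTranspose_mul, conjTranspose_mul, hPT, hPH, hξ]
    simp only [Matrix.mul_assoc]
    rw [nonsing_inv_mul_cancel_left _ _ hPdet]

open Matrix in
lemma aux_sq {n : ℕ} (P : Matrix (Fin n) (Fin n) ℂ) (hP : IsUnit P.det) (d e : Fin n → ℂ) :
    (P * diagonal d * P⁻¹) * (P * diagonal e * P⁻¹)
      = P * diagonal (fun i => d i * e i) * P⁻¹ := by
  rw [← diagonal_mul_diagonal]
  simp only [Matrix.mul_assoc]
  rw [nonsing_inv_mul_cancel_left _ _ hP]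

open Matrix in
lemma aux_unique {n : ℕ} (S T : Matrix (Fin n) (Fin n) ℂ) (h : S * S = T * T)
    (hS : DiagonalizablePosReal S) (hT : DiagonalizablePosReal T) : S = T := by
  obtain ⟨P, d, hP, hd, rfl⟩ := hS
  obtain ⟨Q, e, hQ, he, rfl⟩ := hT
  rw [aux_sq P hP, aux_sq Q hQ] at h
  have key : ∀ a b : Fin n → ℂ, (P * diagonal a * P⁻¹ = Q * diagonal b * Q⁻¹ ↔
      (Q⁻¹ * P) * diagonal a = diagonal b * (Q⁻¹ * P)) := by
    intro a b
    constructor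
    · intro h
      have := congrArg (fun X => Q⁻¹ * X * P) h
      simp only [Matrix.mul_assoc] at this
      rw [nonsing_inv_mul_cancel_left _ _ hQ, nonsing_inv_mul _ hP, Matrix.mul_one] at this
      simpa only [Matrix.mul_assoc] using this
    · intro h
      have := congrArg (fun X => Q * X * P⁻¹) h
      simp only [Matrix.mul_assoc] at this
      rw [mul_nonsing_inv_cancel_left _ _ hQ, mul_nonsing_inv _ hP, Matrix.mul_one] at this
      simpa only [Matrix.mul_assoc] using this
  rw [key] at h ⊢
  ext i j
  have hij := congrFun (congrFun h i) j
  rw [mul_diagonal, diagonal_mul] at hij ⊢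
  by_cases hw : (Q⁻¹ * P) i j = 0
  · simp [hw]
  · rw [mul_comm] at hij
    have h2 := mul_right_cancel₀ hw hij
    have h3 : d j * d j = e i * e i := by exact_mod_cast h2
    have h4 : d j = e i := by nlinarith [hd j, he i, (mul_self_inj (hd j).le (he i).le).1 h3]
    rw [h4, mul_comm]

open Matrix in
lemma aux_spec {n : ℕ} (P : Matrix (Fin n) (Fin n) ℂ) (hP : IsUnit P.det) (d : Fin n → ℂ) :
    spectrum ℂ (P * diagonal d * P⁻¹) = Set.range d := by
  rw [← spectrum_diagonal d]
  have := spectrum.units_conjugate (R := ℂ) (a := diagonal d) (u := P.nonsingInvUnit hP)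
  exact this


/-- if the spectral radius of `M = ξ·G·ξ̄·G` is `< 1`, there is a unique
complex matrix `S` with `S² = 𝟙 − M` which is diagonalizable with positive real
eigenvalues; moreover the eigenvalues of `S` lie in `(0,1]`. -/
theorem statement1 (n : ℕ) (hn : 1 ≤ n)
    (G : Matrix (Fin n) (Fin n) ℝ) (hGsym : G.IsSymm) (hGpd : G.PosDef)
    (ξ : Matrix (Fin n) (Fin n) ℂ) (hξsym : ξ.IsSymm)
    (M : Matrix (Fin n) (Fin n) ℂ)
    (hM : M = ξ * G.map Complex.ofReal * ξ.map (starRingEnd ℂ) * G.map Complex.ofReal)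
    (hspec : ∀ μ ∈ spectrum ℂ M, ‖μ‖ < 1) :
    (∃! S : Matrix (Fin n) (Fin n) ℂ, S * S = 1 - M ∧ DiagonalizablePosReal S) ∧
    (∀ S : Matrix (Fin n) (Fin n) ℂ, S * S = 1 - M → DiagonalizablePosReal S →
      ∀ μ ∈ spectrum ℂ S, ∃ t : ℝ, 0 < t ∧ t ≤ 1 ∧ (t : ℂ) = μ) := by
  obtain ⟨Q, m, hQ, hm, hMQ⟩ := aux_M G hGpd ξ hξsym
  rw [← hM] at hMQ
  have hm1 : ∀ i, m i < 1 := by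
    intro i
    have h := hspec (m i) (by rw [hMQ, aux_spec Q hQ]; exact ⟨i, rfl⟩)
    rw [Complex.norm_real, Real.norm_eq_abs] at h
    exact (abs_lt.1 h).2
  set T : Matrix (Fin n) (Fin n) ℂ :=
    Q * Matrix.diagonal (fun i => ((Real.sqrt (1 - m i) : ℝ) : ℂ)) * Q⁻¹ with hT
  have hTd : DiagonalizablePosReal T :=
    ⟨Q, fun i => Real.sqrt (1 - m i), hQ, fun i => Real.sqrt_pos.2 (by linarith [hm1 i]), rfl⟩
  have hTT : T * T = 1 - M := by
    rw [hT, aux_sq Q hQ, hMQ]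
    have h1 : (1 : Matrix (Fin n) (Fin n) ℂ) = Q * Matrix.diagonal (fun _ => 1) * Q⁻¹ := by
      rw [Matrix.diagonal_one, Matrix.mul_one, Matrix.mul_nonsing_inv _ hQ]
    conv_rhs => rw [h1]
    rw [← Matrix.sub_mul, ← Matrix.mul_sub, Matrix.diagonal_sub]
    congr 3
    funext i
    rw [← Complex.ofReal_mul, Real.mul_self_sqrt (by linarith [hm1 i])]
    push_cast
    rfl
  refine ⟨⟨T, ⟨hTT, hTd⟩, fun S hS => aux_unique S T (hS.1.trans hTT.symm) hS.2 hTd⟩, ?_⟩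
  intro S hS hSd μ hμ
  rw [aux_unique S T (hS.trans hTT.symm) hSd hTd, hT, aux_spec Q hQ] at hμ
  obtain ⟨i, rfl⟩ := hμ
  exact ⟨Real.sqrt (1 - m i), Real.sqrt_pos.2 (by linarith [hm1 i]),
    Real.sqrt_le_one.2 (by linarith [hm i]), rfl⟩
end

section
/- Let n ≥ 1, let ξ : ℝⁿ → Symₙ(ℂ) be a smooth ℤⁿ-periodic map and let u be a periodic symplectic potential such that the spectral radius of M(y) := ξ(y)·D²u(y)·ξ̄(y)·D²u(y) is strictly less than 1 for every y. Then for every smooth ℤⁿ-periodic function ψ : ℝⁿ → ℝ, the function t ↦ F̂(u + tψ, ξ) is differentiable at t = 0 (u + tψ being an admissible potential for |t| small), and its derivative at t = 0 equals −(1/2)·∫_{[0,1]ⁿ} Tr( S(y)·(D²u(y))⁻¹·D²ψ(y) ) dy, where S(y) is the unique complex matrix, diagonalizable with positive real eigenvalues, satisfying S(y)² = 𝟙 − M(y); in particular this integral is a real number. -/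
open MeasureTheory

/-- The Hessian matrix of a function `u : ℝⁿ → ℝ` at a point `y`. -/
noncomputable def hessian (n : ℕ) (u : (Fin n → ℝ) → ℝ) (y : Fin n → ℝ) :
    Matrix (Fin n) (Fin n) ℝ :=
  Matrix.of fun i j =>
    fderiv ℝ (fun z => fderiv ℝ u z (Pi.single j 1)) y (Pi.single i 1)

/-- The function `f̃(x) = 1 − √(1−x) + log((1+√(1−x))/2)`. -/
noncomputable def ftilde (x : ℝ) : ℝ :=
  1 - Real.sqrt (1 - x) + Real.log ((1 + Real.sqrt (1 - x)) / 2)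

/-- `ρ(M) := ∑ᵢ f̃(δᵢ)` over the eigenvalues (roots of the characteristic polynomial,
counted with algebraic multiplicity) of `M`; for `M` diagonalizable with real eigenvalues
in `[0,1)` these roots are real, so taking real parts is harmless. -/
noncomputable def rhoFn {n : ℕ} (M : Matrix (Fin n) (Fin n) ℂ) : ℝ :=
  (M.charpoly.roots.map fun z => ftilde z.re).sum

/-- `ℤⁿ`-periodicity of a function on `ℝⁿ`. -/
def ZnPeriodic {n : ℕ} {α : Type*} (f : (Fin n → ℝ) → α) : Prop :=
  ∀ (y : Fin n → ℝ) (k : Fin n → ℤ), f (y + fun i => (k i : ℝ)) = f y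

/-- A periodic symplectic potential: a smooth `u : ℝⁿ → ℝ` with `u(y) − |y|²/2`
`ℤⁿ`-periodic and `D²u(y)` positive definite for every `y`. -/
def IsSymplecticPotential (n : ℕ) (u : (Fin n → ℝ) → ℝ) : Prop :=
  ContDiff ℝ (⊤ : ℕ∞) u ∧ ZnPeriodic (fun y => u y - (∑ i, (y i) ^ 2) / 2) ∧
    ∀ y, (hessian n u y).PosDef

/-- `M(y) := ξ(y)·D²u(y)·ξ̄(y)·D²u(y)`. -/
noncomputable def Mmat (n : ℕ) (ξ : (Fin n → ℝ) → Matrix (Fin n) (Fin n) ℂ)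
    (u : (Fin n → ℝ) → ℝ) (y : Fin n → ℝ) : Matrix (Fin n) (Fin n) ℂ :=
  ξ y * (hessian n u y).map Complex.ofReal * (ξ y).map (starRingEnd ℂ) *
    (hessian n u y).map Complex.ofReal

/-- The periodic HK-energy
`F̂(u,ξ) = ∫_{[0,1]ⁿ} ( −(1/2)·log det D²u + (1/2)·ρ(ξ·D²u·ξ̄·D²u) )`. -/
noncomputable def Fhat (n : ℕ) (u : (Fin n → ℝ) → ℝ)
    (ξ : (Fin n → ℝ) → Matrix (Fin n) (Fin n) ℂ) : ℝ :=
  ∫ y in Set.pi Set.univ (fun _ : Fin n => Set.Icc (0:ℝ) 1),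
    (-(1/2) * Real.log (hessian n u y).det + (1/2) * rhoFn (Mmat n ξ u y))


open MeasureTheory

/-- Roots of the characteristic polynomial of `1 - X²`. -/
theorem aux_roots_sq {n : ℕ} (M X : Matrix (Fin n) (Fin n) ℂ) (h : X * X = 1 - M) :
    M.charpoly.roots = X.charpoly.roots.map (fun l => 1 - l ^ 2) := by
  have hX : X.charpoly = (X.charpoly.roots.map fun a => Polynomial.X - Polynomial.C a).prod :=
    (IsAlgClosed.splits X.charpoly).eq_prod_roots_of_monic X.charpoly_monic
  have hev : ∀ w : ℂ, X.charpoly.eval w = (X.charpoly.roots.map fun a => w - a).prod := by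
    intro w
    conv_lhs => rw [hX]
    rw [Polynomial.eval_multiset_prod, Multiset.map_map]
    simp
  have key : M.charpoly =
      ((X.charpoly.roots.map (fun l => 1 - l ^ 2)).map
        fun a => Polynomial.X - Polynomial.C a).prod := by
    apply Polynomial.funext
    intro z
    obtain ⟨w, hw⟩ := IsAlgClosed.exists_pow_nat_eq (1 - z) (n := 2) (by norm_num)
    have hz : z = 1 - w ^ 2 := by rw [hw]; ring
    have h1 : M.charpoly.eval z = X.charpoly.eval w * X.charpoly.eval (-w) := by
      rw [Matrix.eval_charpoly, Matrix.eval_charpoly, Matrix.eval_charpoly, ← Matrix.det_mul]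
      congr 1
      have hM : M = 1 - X * X := by rw [h]; abel
      rw [hM, hz]
      have e : ∀ c : ℂ, Matrix.scalar (Fin n) c = c • (1 : Matrix (Fin n) (Fin n) ℂ) := by
        intro c; rw [Matrix.scalar_apply, Matrix.smul_one_eq_diagonal]
      simp only [e, sub_mul, mul_sub, Matrix.smul_mul, Matrix.mul_smul, Matrix.one_mul,
        Matrix.mul_one, smul_smul]
      module
    rw [h1, hev, hev, ← Multiset.prod_map_mul, Polynomial.eval_multiset_prod, Multiset.map_map,
      Multiset.map_map]
    congr 1
    apply Multiset.map_congr rfl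
    intro a _
    simp [hz]
    ring
  rw [key, Polynomial.roots_multiset_prod_X_sub_C]

theorem aux_det_one_add {n : ℕ} (X : Matrix (Fin n) (Fin n) ℂ) :
    (1 + X).det = (X.charpoly.roots.map (fun l => 1 + l)).prod := by
  have hX : X.charpoly = (X.charpoly.roots.map fun a => Polynomial.X - Polynomial.C a).prod :=
    (IsAlgClosed.splits X.charpoly).eq_prod_roots_of_monic X.charpoly_monic
  have h1 : (1 + X) = -(Matrix.scalar (Fin n) (-1 : ℂ) - X) := by
    rw [Matrix.scalar_apply, ← Matrix.smul_one_eq_diagonal]; simp [add_comm]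
  have hcard : X.charpoly.roots.card = n := by
    have := (IsAlgClosed.splits X.charpoly).natDegree_eq_card_roots
    rw [← this, Matrix.charpoly_natDegree_eq_dim, Fintype.card_fin]
  rw [h1, Matrix.det_neg, ← Matrix.eval_charpoly]
  conv_lhs => rw [hX]
  rw [Polynomial.eval_multiset_prod, Multiset.map_map, Fintype.card_fin]
  generalize X.charpoly.roots = s at hcard
  clear h1 hX
  subst hcard
  clear X
  induction s using Multiset.induction with
  | empty => simp
  | cons a s ih =>
    simp only [Multiset.map_cons, Multiset.prod_cons, Multiset.card_cons, ← ih]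
    simp
    ring

theorem aux_multiset_rho (s : Multiset ℂ) (hs : ∀ l ∈ s, 0 < l.re ∧ l.im = 0) :
    (0 < (s.map (fun l => 1 + l)).prod.re ∧ (s.map (fun l => 1 + l)).prod.im = 0) ∧
    (s.map (fun l => ftilde (1 - l ^ 2).re)).sum =
      s.card - s.sum.re + Real.log ((s.map (fun l => 1 + l)).prod.re) - s.card * Real.log 2 := by
  induction s using Multiset.induction with
  | empty => simp
  | cons a s ih =>
    obtain ⟨⟨h1, h2⟩, h3⟩ := ih (fun l hl => hs l (Multiset.mem_cons_of_mem hl))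
    obtain ⟨ha, ha'⟩ := hs a (Multiset.mem_cons_self a s)
    have hre : ((1 + a) * (s.map (fun l => 1 + l)).prod).re
        = (1 + a.re) * (s.map (fun l => 1 + l)).prod.re := by
      simp [ha']
    refine ⟨⟨?_, ?_⟩, ?_⟩
    · rw [Multiset.map_cons, Multiset.prod_cons, hre]; positivity
    · rw [Multiset.map_cons, Multiset.prod_cons]; simp [ha', h2]
    · rw [Multiset.map_cons, Multiset.map_cons, Multiset.prod_cons, hre, Multiset.sum_cons, h3,
        Real.log_mul (by positivity) (by positivity)]
      have : ftilde (1 - a ^ 2).re = 1 - a.re + Real.log (1 + a.re) - Real.log 2 := by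
        have h4 : 1 - (1 - a ^ 2).re = a.re ^ 2 := by simp [pow_two, ha']
        rw [ftilde, h4, Real.sqrt_sq ha.le, Real.log_div (by positivity) (by norm_num)]
        ring
      rw [this]
      simp
      ring

theorem aux_rho_eq {n : ℕ} (M X : Matrix (Fin n) (Fin n) ℂ) (h : X * X = 1 - M)
    (hX : ∀ l ∈ spectrum ℂ X, 0 < l.re) (hM : ∀ d ∈ spectrum ℂ M, d.im = 0) :
    0 < (1 + X).det.re ∧ (1 + X).det.im = 0 ∧
    rhoFn M = n - X.trace.re + Real.log (1 + X).det.re - n * Real.log 2 := by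
  have hcard : X.charpoly.roots.card = n := by
    have := (IsAlgClosed.splits X.charpoly).natDegree_eq_card_roots
    rw [← this, Matrix.charpoly_natDegree_eq_dim, Fintype.card_fin]
  have hs : ∀ l ∈ X.charpoly.roots, 0 < l.re ∧ l.im = 0 := by
    intro l hl
    have h1 : l ∈ spectrum ℂ X :=
      Matrix.mem_spectrum_iff_isRoot_charpoly.2 (Polynomial.isRoot_of_mem_roots hl)
    have h2 : 1 - l ^ 2 ∈ spectrum ℂ M := by
      apply Matrix.mem_spectrum_iff_isRoot_charpoly.2
      apply Polynomial.isRoot_of_mem_roots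
      rw [aux_roots_sq M X h]
      exact Multiset.mem_map_of_mem _ hl
    have h3 := hM _ h2
    have h4 := hX _ h1
    refine ⟨h4, ?_⟩
    simp [pow_two] at h3
    have : l.re * l.im = 0 := by linarith
    rcases mul_eq_zero.1 this with h5 | h5
    · linarith
    · exact h5
  obtain ⟨⟨h1, h2⟩, h3⟩ := aux_multiset_rho _ hs
  rw [← aux_det_one_add] at h1 h2 h3
  refine ⟨h1, h2, ?_⟩
  rw [rhoFn, aux_roots_sq M X h, Multiset.map_map, Matrix.trace_eq_sum_roots_charpoly X]
  rw [hcard] at h3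
  exact h3

/-- Positive diagonalizability. -/
def PosDiag {n : ℕ} (S : Matrix (Fin n) (Fin n) ℂ) : Prop :=
  ∃ (Q : Matrix (Fin n) (Fin n) ℂ) (d : Fin n → ℝ),
      IsUnit Q.det ∧ (∀ i, 0 < d i) ∧
      S = Q * Matrix.diagonal (fun i => (d i : ℂ)) * Q⁻¹

theorem PosDiag.sylv {n : ℕ} {S T Z : Matrix (Fin n) (Fin n) ℂ} (hS : PosDiag S)
    (hT : PosDiag T) (h : S * Z + Z * T = 0) : Z = 0 := by
  obtain ⟨Q, d, hQ, hd, rfl⟩ := hS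
  obtain ⟨P, e, hP, he, rfl⟩ := hT
  have hY : Q⁻¹ * Z * P = 0 := by
    have h1 : Matrix.diagonal (fun i => (d i : ℂ)) * (Q⁻¹ * Z * P) +
        (Q⁻¹ * Z * P) * Matrix.diagonal (fun i => (e i : ℂ)) = 0 := by
      have h2 : Q⁻¹ * (Q * Matrix.diagonal (fun i => (d i : ℂ)) * Q⁻¹ * Z +
        Z * (P * Matrix.diagonal (fun i => (e i : ℂ)) * P⁻¹)) * P = 0 := by
        rw [h]; simp
      rw [← h2]
      simp only [mul_add, add_mul, ← Matrix.mul_assoc, Matrix.nonsing_inv_mul _ hQ]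
      rw [Matrix.mul_assoc _ P⁻¹ P, Matrix.nonsing_inv_mul _ hP]
      simp [Matrix.mul_assoc]
    ext i j
    have h3 := congrFun (congrFun h1 i) j
    rw [Matrix.add_apply, Matrix.diagonal_mul, Matrix.mul_diagonal, mul_comm _ (e j : ℂ),
      ← add_mul] at h3
    rcases mul_eq_zero.1 h3 with h4 | h4
    · exfalso
      have : (d i : ℝ) + e j = 0 := by exact_mod_cast h4
      linarith [hd i, he j]
    · simpa using h4
  have : Z = Q * (Q⁻¹ * Z * P) * P⁻¹ := by
    simp only [← Matrix.mul_assoc, Matrix.mul_nonsing_inv _ hQ]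
    rw [Matrix.mul_assoc, Matrix.mul_nonsing_inv _ hP]
    simp
  rw [this, hY]; simp

theorem PosDiag.intertwine {n : ℕ} {S T W : Matrix (Fin n) (Fin n) ℂ} (hS : PosDiag S)
    (hT : PosDiag T) (h : S * S * W = W * (T * T)) : S * W = W * T := by
  have : S * W - W * T = 0 := by
    apply hS.sylv hT
    simp only [mul_sub, sub_mul, ← Matrix.mul_assoc] at h ⊢
    rw [h]
    simp
  exact sub_eq_zero.1 this

theorem PosDiag.conj {n : ℕ} {S : Matrix (Fin n) (Fin n) ℂ} (hS : PosDiag S) :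
    PosDiag (S.map (starRingEnd ℂ)) := by
  obtain ⟨Q, d, hQ, hd, rfl⟩ := hS
  have hQ' : IsUnit (Q.map (starRingEnd ℂ)).det := by
    have := (hQ.map (starRingEnd ℂ))
    rwa [RingHom.map_det] at this
  refine ⟨Q.map (starRingEnd ℂ), d, hQ', hd, ?_⟩
  rw [Matrix.map_mul, Matrix.map_mul]
  congr 1
  · congr 1
    rw [Matrix.diagonal_map (by simp)]
    congr 1
    ext i
    simp
  · symm
    apply Matrix.inv_eq_left_inv
    rw [← Matrix.map_mul, Matrix.nonsing_inv_mul _ hQ]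
    simp

theorem PosDiag.transpose {n : ℕ} {S : Matrix (Fin n) (Fin n) ℂ} (hS : PosDiag S) :
    PosDiag S.transpose := by
  obtain ⟨Q, d, hQ, hd, rfl⟩ := hS
  refine ⟨(Q⁻¹).transpose, d, ?_, hd, ?_⟩
  · rw [Matrix.det_transpose]; exact Matrix.isUnit_nonsing_inv_det _ hQ
  · rw [Matrix.transpose_mul, Matrix.transpose_mul, Matrix.diagonal_transpose,
      ← Matrix.transpose_nonsing_inv, Matrix.nonsing_inv_nonsing_inv _ hQ, Matrix.mul_assoc]

theorem PosDiag.spec {n : ℕ} {S : Matrix (Fin n) (Fin n) ℂ} (hS : PosDiag S) :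
    ∀ l ∈ spectrum ℂ S, 0 < l.re := by
  obtain ⟨Q, d, hQ, hd, rfl⟩ := hS
  intro l hl
  obtain ⟨q, rfl⟩ := (Matrix.isUnit_iff_isUnit_det _).2 hQ
  rw [← Matrix.coe_units_inv, spectrum.units_conjugate, spectrum_diagonal] at hl
  obtain ⟨i, rfl⟩ := hl
  simpa using hd i

open MeasureTheory

section aux_algebra

variable {n : ℕ}

theorem PosDiag.isUnit_one_add {S : Matrix (Fin n) (Fin n) ℂ} (hS : PosDiag S) :
    IsUnit (1 + S).det := by
  rw [← Matrix.isUnit_iff_isUnit_det]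
  by_contra hcon
  have h1 : (-1 : ℂ) ∈ spectrum ℂ S := by
    rw [spectrum.mem_iff]
    intro hu
    apply hcon
    have : (1 + S) = -(algebraMap ℂ (Matrix (Fin n) (Fin n) ℂ) (-1) - S) := by simp [add_comm]
    rw [this]
    exact hu.neg
  have := hS.spec _ h1
  norm_num at this

/-- Algebraic identities behind the first variation. -/
theorem aux_trace (ξ H K S : Matrix (Fin n) (Fin n) ℂ)
    (hξ : ξ.transpose = ξ) (hHt : H.transpose = H) (hHc : H.map (starRingEnd ℂ) = H)
    (hHu : IsUnit H.det)
    (hKt : K.transpose = K) (hKc : K.map (starRingEnd ℂ) = K)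
    (hS : PosDiag S)
    (hSS : S * S = 1 - ξ * H * ξ.map (starRingEnd ℂ) * H) :
    (S * H⁻¹ * K).trace.im = 0 ∧
    ∀ S' : Matrix (Fin n) (Fin n) ℂ,
      S' * S + S * S' = - (ξ * K * ξ.map (starRingEnd ℂ) * H + ξ * H * ξ.map (starRingEnd ℂ) * K) →
      - S'.trace + ((1 + S)⁻¹ * S').trace = (H⁻¹ * K).trace - (S * H⁻¹ * K).trace := by
  set ζ := ξ.map (starRingEnd ℂ) with hζ
  set T := S.map (starRingEnd ℂ) with hT
  have hζt : ζ.transpose = ζ := by rw [hζ, ← Matrix.transpose_map, hξ]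
  have hζc : ζ.map (starRingEnd ℂ) = ξ := by ext i j; simp [hζ]
  have hTT : T * T = 1 - ζ * H * ξ * H := by
    rw [hT, ← Matrix.map_mul, hSS]
    have := Matrix.map_sub (starRingEnd ℂ) (fun a b => map_sub _ a b) 1 (ξ * H * ζ * H)
    rw [this]
    simp only [Matrix.map_mul, hHc, hζc]
    rw [← hζ]
    simp
  have hSt : S.transpose * S.transpose = 1 - H * ζ * H * ξ := by
    rw [← Matrix.transpose_mul, hSS]
    simp only [Matrix.transpose_sub, Matrix.transpose_mul, hξ, hHt, hζt, Matrix.transpose_one,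
      Matrix.mul_assoc]
  have hcT : PosDiag T := hS.conj
  have i1 : S.transpose * H = H * T := by
    apply hS.transpose.intertwine hcT
    rw [hSt, hTT]
    simp only [sub_mul, mul_sub, Matrix.mul_assoc, Matrix.one_mul, Matrix.mul_one]
  have i2 : S * (ξ * H) = (ξ * H) * T := by
    apply hS.intertwine hcT
    rw [hSS, hTT]
    simp only [sub_mul, mul_sub, Matrix.mul_assoc, Matrix.one_mul, Matrix.mul_one]
  have HH : H * H⁻¹ = 1 := Matrix.mul_nonsing_inv _ hHu
  have HH' : H⁻¹ * H = 1 := Matrix.nonsing_inv_mul _ hHu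
  have hHic : (H⁻¹).map (starRingEnd ℂ) = H⁻¹ := by
    symm
    apply Matrix.inv_eq_left_inv
    conv_lhs => rw [← hHc]
    rw [← Matrix.map_mul, hHc, HH']
    simp
  have hHit : (H⁻¹).transpose = H⁻¹ := by rw [Matrix.transpose_nonsing_inv, hHt]
  have i3 : T * H⁻¹ = H⁻¹ * S.transpose := by
    calc T * H⁻¹ = (H⁻¹ * H) * T * H⁻¹ := by rw [HH', Matrix.one_mul]
      _ = H⁻¹ * (H * T) * H⁻¹ := by simp only [Matrix.mul_assoc]
      _ = H⁻¹ * S.transpose * (H * H⁻¹) := by rw [← i1]; simp only [Matrix.mul_assoc]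
      _ = _ := by rw [HH, Matrix.mul_one]
  have hu1 := hS.isUnit_one_add
  have hu2 := hcT.isUnit_one_add
  have hu3 := hS.transpose.isUnit_one_add
  refine ⟨?_, ?_⟩
  · have h1 : (starRingEnd ℂ) (S * H⁻¹ * K).trace = (S * H⁻¹ * K).trace := by
      have h2 : (starRingEnd ℂ) (S * H⁻¹ * K).trace = (T * H⁻¹ * K).trace := by
        rw [AddMonoidHom.map_trace (starRingEnd ℂ : ℂ →+* ℂ)]
        rw [Matrix.map_mul, Matrix.map_mul, hHic, hKc]
      rw [h2, i3, ← Matrix.trace_transpose, Matrix.transpose_mul, Matrix.transpose_mul,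
        Matrix.transpose_transpose, hKt, hHit, Matrix.trace_mul_comm]
    exact Complex.conj_eq_iff_im.1 h1
  · intro S' hS'
    set R := (1 + S)⁻¹ with hR
    have hR1 : R * (1 + S) = 1 := Matrix.nonsing_inv_mul _ hu1
    have hR2 : (1 + S) * R = 1 := Matrix.mul_nonsing_inv _ hu1
    set P := (1 + T)⁻¹ with hP
    have hP1 : P * (1 + T) = 1 := Matrix.nonsing_inv_mul _ hu2
    have hP2 : (1 + T) * P = 1 := Matrix.mul_nonsing_inv _ hu2
    have hRS : R * S = 1 - R := by
      rw [← hR1]; simp [mul_add]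
    have hSR : S * R = 1 - R := by
      rw [← hR2]; simp [add_mul]
    have j2 : R * (ξ * H) = ξ * H * P := by
      calc R * (ξ * H) = R * (ξ * H) * ((1 + T) * P) := by rw [hP2, Matrix.mul_one]
        _ = R * ((ξ * H) + (ξ * H) * T) * P := by simp only [mul_add, add_mul, Matrix.mul_assoc, Matrix.mul_one, Matrix.one_mul]
        _ = (R * (1 + S)) * (ξ * H) * P := by
          rw [← i2]; simp only [mul_add, add_mul, Matrix.mul_assoc, Matrix.mul_one, Matrix.one_mul]
        _ = _ := by rw [hR1, Matrix.one_mul]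
    have hRt : R.transpose * (1 + S.transpose) = 1 := by
      have := congrArg Matrix.transpose hR2
      simpa [Matrix.transpose_mul] using this
    have j1 : R.transpose * H = H * P := by
      calc R.transpose * H = R.transpose * H * ((1 + T) * P) := by rw [hP2, Matrix.mul_one]
        _ = R.transpose * (H + H * T) * P := by simp only [mul_add, add_mul, Matrix.mul_assoc, Matrix.mul_one, Matrix.one_mul]
        _ = (R.transpose * (1 + S.transpose)) * H * P := by
          rw [← i1]; simp only [mul_add, add_mul, Matrix.mul_assoc, Matrix.mul_one, Matrix.one_mul]
        _ = _ := by rw [hRt, Matrix.one_mul]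
    have t1 : (R * (ξ * H * ζ * K)).trace = (H⁻¹ * K).trace - (S * H⁻¹ * K).trace := by
      have e1 : ξ * H * ζ = (1 - S * S) * H⁻¹ := by
        rw [hSS, sub_sub_cancel, Matrix.mul_assoc (ξ * H * ζ) H, HH, Matrix.mul_one]
      have e2 : R * (1 - S * S) = 1 - S := by
        have : (1 - S * S) = (1 + S) * (1 - S) := by
          simp only [mul_sub, add_mul, Matrix.mul_one, Matrix.one_mul]; abel
        rw [this, ← Matrix.mul_assoc, hR1, Matrix.one_mul]
      rw [e1, ← Matrix.mul_assoc, ← Matrix.mul_assoc, e2, sub_mul, sub_mul, Matrix.one_mul,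
        Matrix.trace_sub]
    have t2 : (R * (ξ * K * ζ * H)).trace = (R * (ξ * H * ζ * K)).trace := by
      rw [← Matrix.trace_transpose]
      have e1 : (R * (ξ * K * ζ * H)).transpose = H * ζ * K * ξ * R.transpose := by
        simp only [Matrix.transpose_mul, hξ, hHt, hKt, hζt, Matrix.mul_assoc]
      have e2 : H * ζ * K * ξ * R.transpose = H * (ζ * K * ξ * R.transpose) := by
        simp only [Matrix.mul_assoc]
      have e3 : (ζ * K * ξ * R.transpose) * H = ζ * K * (R * (ξ * H)) := by
        rw [j2, Matrix.mul_assoc _ _ H, j1]; simp only [Matrix.mul_assoc]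
      rw [e1, e2, Matrix.trace_mul_comm, e3, Matrix.trace_mul_comm]
      simp only [Matrix.mul_assoc]
    have t3 : (R * (S' * S + S * S')).trace = 2 * (S'.trace - (R * S').trace) := by
      rw [mul_add, Matrix.trace_add, ← Matrix.mul_assoc, Matrix.trace_mul_comm, ← Matrix.mul_assoc,
        ← Matrix.mul_assoc, hSR, hRS]
      simp only [sub_mul, Matrix.one_mul, Matrix.trace_sub]
      ring
    rw [hS', mul_neg, Matrix.trace_neg, mul_add, Matrix.trace_add, t2, t1] at t3
    linear_combination t3 / 2

end aux_algebra

open MeasureTheory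

section aux_calculus
open scoped Matrix.Norms.Operator Topology
open Filter

variable {n : ℕ}

theorem aux_spec_open (X₀ : Matrix (Fin n) (Fin n) ℂ) (h : ∀ l ∈ spectrum ℂ X₀, 0 < l.re) :
    ∀ᶠ X in 𝓝 X₀, ∀ l ∈ spectrum ℂ X, 0 < l.re := by
  have h1 := upperHemicontinuousAt_iff.1
    (upperHemicontinuous_spectrum ℂ (Matrix (Fin n) (Fin n) ℂ) X₀)
  have ho : IsOpen {z : ℂ | 0 < z.re} := isOpen_lt continuous_const Complex.continuous_re
  have h2 := h1 {z : ℂ | 0 < z.re} ((ho.mem_nhdsSet).2 h)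
  filter_upwards [h2] with X hX l hl
  exact subset_of_mem_nhdsSet hX hl

theorem aux_local_sqrt (S₀ : Matrix (Fin n) (Fin n) ℂ) (hS : PosDiag S₀) :
    ∃ φ : Matrix (Fin n) (Fin n) ℂ → Matrix (Fin n) (Fin n) ℂ,
      ContDiffAt ℝ 1 φ (S₀ * S₀) ∧ φ (S₀ * S₀) = S₀ ∧
      ∀ᶠ Y in 𝓝 (S₀ * S₀), φ Y * φ Y = Y := by
  let L : Matrix (Fin n) (Fin n) ℂ →ₗ[ℝ] Matrix (Fin n) (Fin n) ℂ :=
    { toFun := fun Z => S₀ * Z + Z * S₀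
      map_add' := by intro a b; rw [mul_add, add_mul]; abel
      map_smul' := by intro c a; simp }
  have hL : Function.Injective L := by
    rw [injective_iff_map_eq_zero]
    intro Z hZ
    exact hS.sylv hS hZ
  let e : Matrix (Fin n) (Fin n) ℂ ≃L[ℝ] Matrix (Fin n) (Fin n) ℂ :=
    (LinearEquiv.ofInjectiveEndo L hL).toContinuousLinearEquiv
  have hf : ContDiffAt ℝ 1 (fun X : Matrix (Fin n) (Fin n) ℂ => X * X) S₀ := by fun_prop
  have hf' : HasFDerivAt (fun X : Matrix (Fin n) (Fin n) ℂ => X * X)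
      (e : Matrix (Fin n) (Fin n) ℂ →L[ℝ] Matrix (Fin n) (Fin n) ℂ) S₀ := by
    have h1 := (hasFDerivAt_id (𝕜 := ℝ) S₀).mul' (hasFDerivAt_id (𝕜 := ℝ) S₀)
    refine h1.congr_fderiv ?_
    ext1 Z
    rfl
  have hs := hf.hasStrictFDerivAt' hf' one_ne_zero
  refine ⟨hf.localInverse hf' one_ne_zero, hf.to_localInverse hf' one_ne_zero,
    hf.localInverse_apply_image hf' one_ne_zero, ?_⟩
  exact hs.eventually_right_inverse

theorem aux_contDiff_matrix {E : Type*} [NormedAddCommGroup E] [NormedSpace ℝ E]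
    {f : E → Matrix (Fin n) (Fin n) ℂ} {k : WithTop ℕ∞} {x : E}
    (h : ∀ i j, ContDiffAt ℝ k (fun y => f y i j) x) : ContDiffAt ℝ k f x := by
  have h1 : f = fun y => ∑ i, ∑ j, (f y i j) • Matrix.single i j (1 : ℂ) := by
    funext y
    conv_lhs => rw [Matrix.matrix_eq_sum_single (f y)]
    simp [Matrix.smul_single]
  rw [h1]
  apply ContDiffAt.sum; intro i _
  apply ContDiffAt.sum; intro j _
  exact (h i j).smul contDiffAt_const

/-- Evaluation of an entry as a continuous linear map. -/
noncomputable def entryCLM (i j : Fin n) : Matrix (Fin n) (Fin n) ℂ →L[ℝ] ℂ :=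
  LinearMap.toContinuousLinearMap
    { toFun := fun A => A i j
      map_add' := fun _ _ => rfl
      map_smul' := fun _ _ => rfl }

theorem aux_contDiff_entry (i j : Fin n) {k : WithTop ℕ∞} :
    ContDiff ℝ k (fun A : Matrix (Fin n) (Fin n) ℂ => A i j) :=
  (entryCLM i j).contDiff

theorem aux_contDiff_det {k : WithTop ℕ∞} :
    ContDiff ℝ k (fun A : Matrix (Fin n) (Fin n) ℂ => A.det) := by
  simp only [Matrix.det_apply]
  apply ContDiff.sum; intro σ _
  apply ContDiff.const_smul
  apply contDiff_prod; intro i _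
  exact aux_contDiff_entry _ _

theorem aux_contDiff_trace {k : WithTop ℕ∞} :
    ContDiff ℝ k (fun A : Matrix (Fin n) (Fin n) ℂ => A.trace) := by
  simp only [Matrix.trace, Matrix.diag]
  apply ContDiff.sum; intro i _
  exact aux_contDiff_entry _ _

theorem aux_det_deriv_one (B : Matrix (Fin n) (Fin n) ℂ) :
    HasDerivAt (fun s : ℝ => (1 + s • B).det) B.trace 0 := by
  have h1 := (Matrix.det (1 + (Polynomial.X : Polynomial ℂ) • B.map Polynomial.C)).hasDerivAt
    ((0 : ℝ) : ℂ)
  have h2 := h1.comp_ofReal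
  rw [Complex.ofReal_zero, Matrix.derivative_det_one_add_X_smul] at h2
  refine h2.congr_of_eventuallyEq (Eventually.of_forall fun s => ?_)
  have h3 := (Polynomial.evalRingHom (s : ℂ)).map_det
    (1 + (Polynomial.X : Polynomial ℂ) • B.map Polynomial.C)
  rw [Polynomial.coe_evalRingHom] at h3
  refine Eq.trans ?_ h3.symm
  refine congrArg Matrix.det ?_
  ext i j
  by_cases hij : i = j
  · subst hij
    simp
    ring
  · simp [hij]
    ring

theorem aux_det_deriv {X : ℝ → Matrix (Fin n) (Fin n) ℂ} {X' : Matrix (Fin n) (Fin n) ℂ} {t : ℝ}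
    (hX : HasDerivAt X X' t) (hu : IsUnit (X t).det) :
    HasDerivAt (fun s => (X s).det) ((X t).det * ((X t)⁻¹ * X').trace) t := by
  have hd : DifferentiableAt ℝ (fun A : Matrix (Fin n) (Fin n) ℂ => A.det) (X t) :=
    (aux_contDiff_det (k := 1)).contDiffAt.differentiableAt one_ne_zero
  have h1 := hd.hasFDerivAt.comp_hasDerivAt t hX
  have key : fderiv ℝ (fun A : Matrix (Fin n) (Fin n) ℂ => A.det) (X t) X' =
      (X t).det * ((X t)⁻¹ * X').trace := by
    have h2 : HasDerivAt (fun s : ℝ => X t + s • X') X' 0 := by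
      have h0 := ((hasDerivAt_id (0 : ℝ)).smul_const X').const_add (X t)
      rw [one_smul] at h0
      exact h0
    have hd' : DifferentiableAt ℝ (fun A : Matrix (Fin n) (Fin n) ℂ => A.det)
      (X t + (0 : ℝ) • X') := by simpa using hd
    have h3 := hd'.hasFDerivAt.comp_hasDerivAt (0 : ℝ) h2
    have h4 := (aux_det_deriv_one ((X t)⁻¹ * X')).const_mul (X t).det
    have h5 : ((fun A : Matrix (Fin n) (Fin n) ℂ => A.det) ∘ fun s : ℝ => X t + s • X') =
        fun s : ℝ => (X t).det * (1 + s • ((X t)⁻¹ * X')).det := by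
      funext s
      simp only [Function.comp]
      rw [← Matrix.det_mul, mul_add, Matrix.mul_one, Matrix.mul_smul, ← Matrix.mul_assoc,
        Matrix.mul_nonsing_inv _ hu, Matrix.one_mul]
    rw [h5] at h3
    have h6 := h3.unique h4
    rw [zero_smul, add_zero] at h6
    exact h6
  exact h1.congr_deriv key

end aux_calculus

open MeasureTheory

section aux_int
open scoped Topology
open Filter

theorem aux_integral {n : ℕ} (K : Set (Fin n → ℝ)) (hK : IsCompact K)
    (G : ℝ × (Fin n → ℝ) → ℝ) (hG : ∀ y ∈ K, ContDiffAt ℝ 1 G (0, y)) (g : (Fin n → ℝ) → ℝ)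
    (hg : ∀ y ∈ K, HasDerivAt (fun t => G (t, y)) (g y) 0) :
    HasDerivAt (fun t => ∫ y in K, G (t, y)) (∫ y in K, g y) 0 := by
  have h1 : ∀ᶠ t in 𝓝 (0 : ℝ), ∀ y ∈ K, ContDiffAt ℝ 1 G (t, y) := by
    apply hK.eventually_forall_of_forall_eventually
    intro y hy
    exact (hG y hy).eventually (by simp)
  obtain ⟨ε, hε, hball⟩ := Metric.eventually_nhds_iff_ball.1 h1
  have h2 : ∀ p ∈ Metric.closedBall (0 : ℝ) (ε / 2) ×ˢ K, ContDiffAt ℝ 1 G p := by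
    rintro ⟨t, y⟩ ⟨ht, hy⟩
    exact hball t (Metric.closedBall_subset_ball (by linarith) ht) y hy
  have hc : ContinuousOn (fderiv ℝ G) (Metric.closedBall (0 : ℝ) (ε / 2) ×ˢ K) := by
    intro p hp
    have : ContDiffAt ℝ 0 (fderiv ℝ G) p := (h2 p hp).fderiv_right (by simp)
    exact this.continuousAt.continuousWithinAt
  obtain ⟨C, hC⟩ := ((isCompact_closedBall (0 : ℝ) (ε / 2)).prod hK).exists_bound_of_continuousOn hc
  have hmK : MeasurableSet K := hK.isClosed.measurableSet
  have hder : ∀ y ∈ K, ∀ t ∈ Metric.closedBall (0 : ℝ) (ε / 2),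
      HasDerivAt (fun t => G (t, y)) (fderiv ℝ G (t, y) (1, 0)) t := by
    intro y hy t ht
    have h3 : HasFDerivAt G (fderiv ℝ G (t, y)) (t, y) :=
      ((h2 (t, y) ⟨ht, hy⟩).differentiableAt one_ne_zero).hasFDerivAt
    have h4 : HasDerivAt (fun t : ℝ => (t, y)) ((1 : ℝ), (0 : Fin n → ℝ)) t :=
      (hasDerivAt_id t).prodMk (hasDerivAt_const t y)
    exact h3.comp_hasDerivAt t h4
  have hcont : ∀ t ∈ Metric.closedBall (0 : ℝ) (ε / 2), ContinuousOn (fun y => G (t, y)) K := by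
    intro t ht y hy
    have h3 : ContinuousAt G (t, y) := (h2 (t, y) ⟨ht, hy⟩).continuousAt
    have h4 : ContinuousAt (fun y : Fin n → ℝ => (t, y)) y := by fun_prop
    exact (ContinuousAt.comp (f := fun y : Fin n → ℝ => (t, y)) h3 h4).continuousWithinAt
  have h0 : (0 : ℝ) ∈ Metric.closedBall (0 : ℝ) (ε / 2) :=
    Metric.mem_closedBall_self (by linarith)
  have hnb : Metric.closedBall (0 : ℝ) (ε / 2) ∈ 𝓝 (0 : ℝ) :=
    Metric.closedBall_mem_nhds _ (by linarith)
  have hc0 : ContinuousOn (fun y => fderiv ℝ G (0, y) (1, 0)) K := by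
    intro y hy
    have : ContDiffAt ℝ 0 (fderiv ℝ G) ((0 : ℝ), y) := (h2 (0, y) ⟨h0, hy⟩).fderiv_right (by simp)
    have h3 := this.continuousAt
    have h4 : ContinuousAt (fun y : Fin n → ℝ => ((0 : ℝ), y)) y := by fun_prop
    have h5 := ContinuousAt.comp (f := fun y : Fin n → ℝ => ((0 : ℝ), y)) h3 h4
    exact (h5.clm_apply continuousAt_const).continuousWithinAt
  have main := hasDerivAt_integral_of_dominated_loc_of_deriv_le (μ := volume.restrict K)
    (F := fun t y => G (t, y)) (F' := fun t y => fderiv ℝ G (t, y) (1, 0))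
    (x₀ := (0 : ℝ)) (bound := fun _ => C * ‖((1 : ℝ), (0 : Fin n → ℝ))‖) hnb
    (by
      filter_upwards [hnb] with t ht
      exact (hcont t ht).aestronglyMeasurable hmK)
    ((hcont 0 h0).integrableOn_compact hK)
    (hc0.aestronglyMeasurable hmK)
    (by
      filter_upwards [ae_restrict_mem hmK] with y hy t ht
      exact (ContinuousLinearMap.le_opNorm _ _).trans
        (mul_le_mul_of_nonneg_right (hC _ ⟨ht, hy⟩) (norm_nonneg _)))
    (by
      have : IsFiniteMeasure (volume.restrict K) := ⟨by
        rw [Measure.restrict_apply_univ]; exact hK.measure_lt_top⟩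
      exact integrable_const _)
    (by
      filter_upwards [ae_restrict_mem hmK] with y hy t ht
      exact hder y hy t ht)
  have heq : ∫ y in K, g y = ∫ y in K, fderiv ℝ G (0, y) (1, 0) := by
    apply setIntegral_congr_fun hmK
    intro y hy
    exact (hg y hy).unique (hder y hy 0 h0)
  rw [heq]
  exact main.2

end aux_int

section aux_spec
open scoped ComplexOrder
variable {n : ℕ}

theorem aux_posDef_spec (H : Matrix (Fin n) (Fin n) ℝ) (hH : H.PosDef) :
    ∀ l ∈ spectrum ℂ (H.map Complex.ofReal), 0 < l.re := by
  intro l hl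
  rw [Matrix.mem_spectrum_iff_isRoot_charpoly] at hl
  have h1 : (H.map Complex.ofReal).charpoly = H.charpoly.map Complex.ofRealHom :=
    Matrix.charpoly_map H Complex.ofRealHom
  rw [h1, hH.isHermitian.charpoly_eq, Polynomial.map_prod, Polynomial.IsRoot,
    Polynomial.eval_prod, Finset.prod_eq_zero_iff] at hl
  obtain ⟨i, _, hi⟩ := hl
  have h2 := hH.eigenvalues_pos i
  simp [sub_eq_zero] at hi
  rw [hi]
  simpa using h2

theorem aux_spec_posDef (H : Matrix (Fin n) (Fin n) ℂ) (hH : H.IsHermitian)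
    (h : ∀ l ∈ spectrum ℂ H, 0 < l.re) : H.PosDef := by
  rw [hH.posDef_iff_eigenvalues_pos]
  intro i
  have h1 : ((hH.eigenvalues i : ℝ) : ℂ) ∈ spectrum ℂ H := by
    rw [hH.spectrum_eq_image_range]
    exact ⟨_, ⟨i, rfl⟩, rfl⟩
  simpa using h _ h1

theorem aux_spec_real (A H : Matrix (Fin n) (Fin n) ℂ) (hA : A.IsHermitian) (hH : H.PosDef) :
    ∀ d ∈ spectrum ℂ (A * H), d.im = 0 := by
  intro d hd
  rw [Matrix.mem_spectrum_iff_isRoot_charpoly, Polynomial.IsRoot, Matrix.eval_charpoly] at hd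
  obtain ⟨v, hv, hv'⟩ := Matrix.exists_mulVec_eq_zero_iff.2 hd
  have h1 : (A * H).mulVec v = d • v := by
    rw [Matrix.sub_mulVec, sub_eq_zero] at hv'
    rw [← hv']
    simp [Matrix.scalar_apply, ← Matrix.smul_one_eq_diagonal, Matrix.smul_mulVec]
  have hHAH : (H * A * H).IsHermitian := by
    have := Matrix.isHermitian_conjTranspose_mul_mul H hA
    rwa [hH.isHermitian.eq] at this
  have h2 := hHAH.im_star_dotProduct_mulVec_self v
  have h3 := hH.isHermitian.im_star_dotProduct_mulVec_self v
  have h4 := hH.re_dotProduct_pos hv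
  have h5 : (H * A * H).mulVec v = d • H.mulVec v := by
    rw [Matrix.mul_assoc, ← Matrix.mulVec_mulVec, h1, Matrix.mulVec_smul]
  rw [h5, dotProduct_smul] at h2
  simp only [smul_eq_mul, RCLike.im_eq_complex_im, RCLike.re_eq_complex_re] at h2 h3 h4
  rw [Complex.mul_im, h3, mul_zero, zero_add] at h2
  rcases mul_eq_zero.1 h2 with h | h
  · exact h
  · linarith
end aux_spec

open MeasureTheory

section aux_main
open scoped Matrix.Norms.Operator Topology
open Filter

variable {n : ℕ}

theorem aux_contDiff_M {E : Type*} [NormedAddCommGroup E] [NormedSpace ℝ E]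
    (ξ H : E → Matrix (Fin n) (Fin n) ℂ) (p₀ : E)
    (hξ : ContDiffAt ℝ 1 ξ p₀) (hH : ContDiffAt ℝ 1 H p₀) :
    ContDiffAt ℝ 1 (fun p => ξ p * H p * (ξ p).map (starRingEnd ℂ) * H p) p₀ := by
  have h1 : ContDiffAt ℝ 1 (fun p => (ξ p).map (starRingEnd ℂ)) p₀ := by
    apply aux_contDiff_matrix
    intro i j
    have h2 : ContDiffAt ℝ 1 (fun p => ξ p i j) p₀ :=
      (aux_contDiff_entry i j).contDiffAt.comp p₀ hξ
    exact (Complex.conjCLE.contDiff (n := 1)).contDiffAt.comp p₀ h2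
  exact ((hξ.mul hH).mul h1).mul hH

theorem aux_local {E : Type*} [NormedAddCommGroup E] [NormedSpace ℝ E]
    (ξ H : E → Matrix (Fin n) (Fin n) ℂ) (p₀ : E)
    (hξ : ContDiffAt ℝ 1 ξ p₀) (hH : ContDiffAt ℝ 1 H p₀)
    (hsym : ∀ p, (ξ p).transpose = ξ p) (hHh : ∀ p, (H p).IsHermitian)
    (hpos : ∀ l ∈ spectrum ℂ (H p₀), 0 < l.re)
    (S₀ : Matrix (Fin n) (Fin n) ℂ) (hS : PosDiag S₀)
    (hSS : S₀ * S₀ = 1 - ξ p₀ * H p₀ * (ξ p₀).map (starRingEnd ℂ) * H p₀) :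
    ∃ X : E → Matrix (Fin n) (Fin n) ℂ, ContDiffAt ℝ 1 X p₀ ∧ X p₀ = S₀ ∧
      ∀ᶠ p in 𝓝 p₀, X p * X p = 1 - ξ p * H p * (ξ p).map (starRingEnd ℂ) * H p ∧
        0 < (1 + X p).det.re ∧ (1 + X p).det.im = 0 ∧
        rhoFn (ξ p * H p * (ξ p).map (starRingEnd ℂ) * H p) =
          n - (X p).trace.re + Real.log (1 + X p).det.re - n * Real.log 2 := by
  obtain ⟨φ, hφ, hφ0, hφe⟩ := aux_local_sqrt S₀ hS
  have hM : ContDiffAt ℝ 1 (fun p => 1 - ξ p * H p * (ξ p).map (starRingEnd ℂ) * H p) p₀ :=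
    contDiffAt_const.sub (aux_contDiff_M ξ H p₀ hξ hH)
  rw [hSS] at hφ hφ0 hφe
  have hX : ContDiffAt ℝ 1 (fun p => φ (1 - ξ p * H p * (ξ p).map (starRingEnd ℂ) * H p)) p₀ :=
    ContDiffAt.comp p₀ hφ hM
  refine ⟨fun p => φ (1 - ξ p * H p * (ξ p).map (starRingEnd ℂ) * H p), hX, hφ0, ?_⟩
  have e1 := hM.continuousAt.eventually hφe
  have hs0 := hS.spec
  rw [← hφ0] at hs0
  have e2 := hX.continuousAt.eventually (aux_spec_open _ hs0)
  have e3 := hH.continuousAt.eventually (aux_spec_open _ hpos)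
  filter_upwards [e1, e2, e3] with p h1 h2 h3
  refine ⟨h1, ?_⟩
  apply aux_rho_eq _ _ h1 h2
  apply aux_spec_real _ _ _ (aux_spec_posDef _ (hHh p) h3)
  have h4 : (ξ p).map (starRingEnd ℂ) = (ξ p).conjTranspose := by
    rw [Matrix.conjTranspose, hsym p]; rfl
  rw [h4]
  exact Matrix.isHermitian_mul_mul_conjTranspose _ (hHh p)

/-- The energy density. -/
noncomputable def aux_dens (ξ : Matrix (Fin n) (Fin n) ℂ) (H : Matrix (Fin n) (Fin n) ℝ) : ℝ :=
  -(1/2) * Real.log H.det + (1/2) * rhoFn (ξ * H.map Complex.ofReal *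
    ξ.map (starRingEnd ℂ) * H.map Complex.ofReal)

theorem aux_det_ofReal (H : Matrix (Fin n) (Fin n) ℝ) :
    (H.map Complex.ofReal).det = (H.det : ℂ) :=
  (Complex.ofRealHom.map_det H).symm

theorem aux_dens_contDiffAt {E : Type*} [NormedAddCommGroup E] [NormedSpace ℝ E]
    (ξ : E → Matrix (Fin n) (Fin n) ℂ) (H : E → Matrix (Fin n) (Fin n) ℝ) (p₀ : E)
    (hξ : ∀ i j, ContDiffAt ℝ 1 (fun p => ξ p i j) p₀)
    (hH : ∀ i j, ContDiffAt ℝ 1 (fun p => H p i j) p₀)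
    (hsym : ∀ p, (ξ p).transpose = ξ p) (hHh : ∀ p, (H p).transpose = H p)
    (hpos : (H p₀).PosDef)
    (S₀ : Matrix (Fin n) (Fin n) ℂ) (hS : PosDiag S₀)
    (hSS : S₀ * S₀ = 1 - ξ p₀ * (H p₀).map Complex.ofReal * (ξ p₀).map (starRingEnd ℂ) *
      (H p₀).map Complex.ofReal) :
    ContDiffAt ℝ 1 (fun p => aux_dens (ξ p) (H p)) p₀ := by
  have hHC : ContDiffAt ℝ 1 (fun p => (H p).map Complex.ofReal) p₀ := by
    apply aux_contDiff_matrix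
    intro i j
    exact (Complex.ofRealCLM.contDiff (n := 1)).contDiffAt.comp p₀ (hH i j)
  have hherm : ∀ p, ((H p).map Complex.ofReal).IsHermitian := by
    intro p
    ext i j
    have := congrFun (congrFun (hHh p) i) j
    simp only [Matrix.transpose_apply] at this
    simp [this]
  obtain ⟨X, hX, hX0, hXe⟩ := aux_local ξ (fun p => (H p).map Complex.ofReal) p₀
    (aux_contDiff_matrix hξ) hHC hsym hherm (aux_posDef_spec _ hpos) S₀ hS hSS
  have hre : ContDiff ℝ 1 Complex.re := Complex.reCLM.contDiff
  have c1 : ContDiffAt ℝ 1 (fun p => (H p).det) p₀ := by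
    have : (fun p => (H p).det) = fun p => (((H p).map Complex.ofReal).det).re := by
      funext p; rw [aux_det_ofReal, Complex.ofReal_re]
    rw [this]
    exact hre.contDiffAt.comp p₀ (aux_contDiff_det.contDiffAt.comp p₀ hHC)
  have c2 : ContDiffAt ℝ 1 (fun p => (X p).trace.re) p₀ :=
    hre.contDiffAt.comp p₀ (aux_contDiff_trace.contDiffAt.comp p₀ hX)
  have c3 : ContDiffAt ℝ 1 (fun p => (1 + X p).det.re) p₀ :=
    hre.contDiffAt.comp p₀ (aux_contDiff_det.contDiffAt.comp p₀ (contDiffAt_const.add hX))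
  have hne : (1 + X p₀).det.re ≠ 0 := (hXe.self_of_nhds).2.1.ne'
  have hne' : (H p₀).det ≠ 0 := hpos.det_pos.ne'
  have c4 : ContDiffAt ℝ 1 (fun p => -(1/2) * Real.log (H p).det + (1/2) *
      (n - (X p).trace.re + Real.log (1 + X p).det.re - n * Real.log 2)) p₀ :=
    (contDiffAt_const.mul (c1.log hne')).add (contDiffAt_const.mul
      (((contDiffAt_const.sub c2).add (c3.log hne)).sub contDiffAt_const))
  refine c4.congr_of_eventuallyEq ?_
  filter_upwards [hXe] with p hp
  rw [aux_dens, hp.2.2.2]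

theorem aux_dens_deriv (ξ : Matrix (Fin n) (Fin n) ℂ) (H K : Matrix (Fin n) (Fin n) ℝ)
    (hsym : ξ.transpose = ξ) (hKt : K.transpose = K)
    (hpos : H.PosDef)
    (S : Matrix (Fin n) (Fin n) ℂ) (hS : PosDiag S)
    (hSS : S * S = 1 - ξ * H.map Complex.ofReal * ξ.map (starRingEnd ℂ) *
      H.map Complex.ofReal) :
    (S * (H.map Complex.ofReal)⁻¹ * K.map Complex.ofReal).trace.im = 0 ∧
    HasDerivAt (fun t : ℝ => aux_dens ξ (H + t • K))
      (-(1/2) * (S * (H.map Complex.ofReal)⁻¹ * K.map Complex.ofReal).trace.re) 0 := by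
  set Hc := H.map Complex.ofReal with hHc
  set Kc := K.map Complex.ofReal with hKc
  have hHt : H.transpose = H := by simpa using hpos.isHermitian.eq
  have hu : IsUnit Hc.det := by
    rw [hHc, aux_det_ofReal]
    exact isUnit_iff_ne_zero.2 (by exact_mod_cast hpos.det_pos.ne')
  have hHt' : ∀ t : ℝ, (H + t • K).transpose = H + t • K := by
    intro t; rw [Matrix.transpose_add, Matrix.transpose_smul, hHt, hKt]
  have hline : ∀ t : ℝ, (H + t • K).map Complex.ofReal = Hc + t • Kc := by
    intro t; ext i j; simp [hHc, hKc]
  obtain ⟨hA, hB⟩ := aux_trace ξ Hc Kc S hsym (by rw [hHc, ← Matrix.transpose_map, hHt])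
    (by ext i j; simp [hHc]) hu (by rw [hKc, ← Matrix.transpose_map, hKt])
    (by ext i j; simp [hKc]) hS hSS
  refine ⟨hA, ?_⟩
  have hlin : HasDerivAt (fun t : ℝ => Hc + t • Kc) Kc 0 := by
    have h0 := ((hasDerivAt_id (0 : ℝ)).smul_const Kc).const_add Hc
    rw [one_smul] at h0
    exact h0
  have hlinC : ContDiffAt ℝ 1 (fun t : ℝ => Hc + t • Kc) 0 := by fun_prop
  have hherm : ∀ t : ℝ, (Hc + t • Kc).IsHermitian := by
    intro p
    rw [← hline]
    ext i j
    have := congrFun (congrFun (hHt' p) i) j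
    rw [Matrix.transpose_apply] at this
    simp only [Matrix.conjTranspose_apply, Matrix.map_apply, this]
    simp
  have h00 : Hc + (0 : ℝ) • Kc = Hc := by simp
  obtain ⟨X, hX, hX0, hXe⟩ := aux_local (fun _ : ℝ => ξ) (fun t : ℝ => Hc + t • Kc) 0
    contDiffAt_const hlinC (fun _ => hsym) hherm (by rw [h00]; exact aux_posDef_spec _ hpos) S hS
    (by rw [h00]; exact hSS)
  have hXd : HasDerivAt X (deriv X 0) 0 := (hX.differentiableAt one_ne_zero).hasDerivAt
  set S' := deriv X 0 with hS'
  have hM : HasDerivAt (fun t : ℝ => 1 - ξ * (Hc + t • Kc) * ξ.map (starRingEnd ℂ) * (Hc + t • Kc))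
      (-(ξ * Kc * ξ.map (starRingEnd ℂ) * Hc + ξ * Hc * ξ.map (starRingEnd ℂ) * Kc)) 0 := by
    have h1 := (((hlin.const_mul ξ).mul_const (ξ.map (starRingEnd ℂ))).mul hlin).const_sub 1
    refine h1.congr_deriv ?_
    simp
  have hXX : HasDerivAt (fun t => X t * X t) (S' * S + S * S') 0 := by
    have h1 := hXd.mul hXd
    rw [hX0] at h1
    exact h1
  have hrel := hXX.unique (hM.congr_of_eventuallyEq (hXe.mono fun p hp => hp.1))
  have hB' := hB S' hrel
  have d1 : HasDerivAt (fun t : ℝ => (H + t • K).det) (H.det * (Hc⁻¹ * Kc).trace.re) 0 := by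
    have h1 := aux_det_deriv hlin (by rw [h00]; exact hu)
    rw [h00] at h1
    have h2 := (Complex.reCLM.hasFDerivAt).comp_hasDerivAt (0 : ℝ) h1
    have h3 : (Complex.reCLM ∘ fun s : ℝ => (Hc + s • Kc).det) = fun t : ℝ => (H + t • K).det := by
      funext t
      simp only [Function.comp]
      rw [← hline, aux_det_ofReal]; simp
    rw [h3] at h2
    refine h2.congr_deriv ?_
    rw [hHc, aux_det_ofReal]; simp
  have d2 : HasDerivAt (fun t : ℝ => (X t).trace.re) (S'.trace.re) 0 := by
    let L : Matrix (Fin n) (Fin n) ℂ →L[ℝ] ℂ := LinearMap.toContinuousLinearMap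
      (Matrix.traceLinearMap (Fin n) ℝ ℂ)
    have h1 := (Complex.reCLM.comp L).hasFDerivAt.comp_hasDerivAt (0 : ℝ) hXd
    exact h1
  have hd := hXe.self_of_nhds
  have d3 : HasDerivAt (fun t : ℝ => (1 + X t).det.re)
      ((1 + S).det.re * ((1 + S)⁻¹ * S').trace.re) 0 := by
    have h1 := aux_det_deriv (hXd.const_add 1) (by rw [hX0]; exact hS.isUnit_one_add)
    rw [hX0] at h1
    have h2 := (Complex.reCLM.hasFDerivAt).comp_hasDerivAt (0 : ℝ) h1
    refine h2.congr_deriv ?_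
    have h3 := hd.2.2.1
    rw [hX0] at h3
    simp [Complex.mul_re, h3]
  have hp3 := hd.2.1
  have d1' := d1.log (by simpa using hpos.det_pos.ne')
  have d3' := d3.log hp3.ne'
  have d4 := (d1'.const_mul (-(1/2))).add
    ((((d2.const_sub (n : ℝ)).add d3').sub_const (n * Real.log 2)).const_mul (1/2))
  refine (d4.congr_of_eventuallyEq (f₁ := fun t : ℝ => aux_dens ξ (H + t • K)) ?_).congr_deriv ?_
  · filter_upwards [hXe] with t ht
    rw [aux_dens, hline, ht.2.2.2]
    rfl
  rw [hX0] at hp3 ⊢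
  rw [zero_smul, add_zero, mul_div_cancel_left₀ _ hpos.det_pos.ne',
    mul_div_cancel_left₀ _ hp3.ne']
  have h6 := congrArg Complex.re hB'
  simp only [Complex.add_re, Complex.neg_re, Complex.sub_re] at h6
  linear_combination (1/2) * h6

end aux_main

open MeasureTheory

section aux_hess
variable {n : ℕ}

theorem aux_fderiv_apply_contDiff (u : (Fin n → ℝ) → ℝ) (hu : ContDiff ℝ (⊤ : ℕ∞) u)
    (v : Fin n → ℝ) : ContDiff ℝ (⊤ : ℕ∞) (fun z => fderiv ℝ u z v) :=
  (hu.fderiv_right (m := (⊤ : ℕ∞)) (by simp)).clm_apply contDiff_const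

theorem aux_hess_contDiff (u : (Fin n → ℝ) → ℝ) (hu : ContDiff ℝ (⊤ : ℕ∞) u) (i j : Fin n) :
    ContDiff ℝ (⊤ : ℕ∞) (fun y => hessian n u y i j) :=
  aux_fderiv_apply_contDiff _ (aux_fderiv_apply_contDiff u hu _) _

theorem aux_hess_add (u ψ : (Fin n → ℝ) → ℝ) (hu : ContDiff ℝ (⊤ : ℕ∞) u)
    (hψ : ContDiff ℝ (⊤ : ℕ∞) ψ) (t : ℝ) (y : Fin n → ℝ) :
    hessian n (fun y => u y + t * ψ y) y = hessian n u y + t • hessian n ψ y := by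
  have key : ∀ (f g : (Fin n → ℝ) → ℝ), ContDiff ℝ (⊤ : ℕ∞) f → ContDiff ℝ (⊤ : ℕ∞) g →
      ∀ z v, fderiv ℝ (fun y => f y + t * g y) z v = fderiv ℝ f z v + t * fderiv ℝ g z v := by
    intro f g hf hg z v
    have hf' := (hf.differentiable (by simp) z).hasFDerivAt
    have hg' := (hg.differentiable (by simp) z).hasFDerivAt
    have := (hf'.add (hg'.const_mul t)).fderiv
    have h2 := congrArg (fun L : (Fin n → ℝ) →L[ℝ] ℝ => L v) this
    simp only [add_apply, smul_apply, smul_eq_mul] at h2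
    exact h2
  ext i j
  simp only [hessian, Matrix.of_apply, Matrix.add_apply, Matrix.smul_apply, smul_eq_mul]
  simp only [key u ψ hu hψ]
  exact key _ _ (aux_fderiv_apply_contDiff u hu _) (aux_fderiv_apply_contDiff ψ hψ _) _ _

theorem aux_hess_symm (u : (Fin n → ℝ) → ℝ) (hu : ContDiff ℝ (⊤ : ℕ∞) u) (y : Fin n → ℝ) :
    (hessian n u y).transpose = hessian n u y := by
  have hs : IsSymmSndFDerivAt ℝ u y :=
    hu.contDiffAt.isSymmSndFDerivAt (by
      simp only [minSmoothness_of_isRCLikeNormedField]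
      exact WithTop.coe_le_coe.2 (le_top : (2 : ℕ∞) ≤ ⊤))
  have hd : DifferentiableAt ℝ (fderiv ℝ u) y :=
    (hu.fderiv_right (m := (⊤ : ℕ∞)) (by simp)).differentiable (by simp) y
  have key : ∀ v w, fderiv ℝ (fun z => fderiv ℝ u z v) y w = fderiv ℝ (fderiv ℝ u) y w v := by
    intro v w
    rw [fderiv_clm_apply hd (differentiableAt_const v)]
    simp
  ext i j
  simp only [hessian, Matrix.transpose_apply, Matrix.of_apply, key]
  exact hs _ _

end aux_hess

/-- first variation of the periodic HK-energy. -/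
theorem statement6 (n : ℕ) (hn : 1 ≤ n)
    (ξ : (Fin n → ℝ) → Matrix (Fin n) (Fin n) ℂ)
    (hξsmooth : ∀ a b, ContDiff ℝ (⊤ : ℕ∞) fun y => ξ y a b)
    (hξper : ZnPeriodic ξ)
    (hξsym : ∀ y, (ξ y).IsSymm)
    (u : (Fin n → ℝ) → ℝ) (hu : IsSymplecticPotential n u)
    (hspec : ∀ y, ∀ μ ∈ spectrum ℂ (Mmat n ξ u y), ‖μ‖ < 1)
    (S : (Fin n → ℝ) → Matrix (Fin n) (Fin n) ℂ)
    (hSsq : ∀ y, S y * S y = 1 - Mmat n ξ u y)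
    (hSdiag : ∀ y, ∃ (Q : Matrix (Fin n) (Fin n) ℂ) (d : Fin n → ℝ),
      IsUnit Q.det ∧ (∀ i, 0 < d i) ∧
      S y = Q * Matrix.diagonal (fun i => (d i : ℂ)) * Q⁻¹)
    (ψ : (Fin n → ℝ) → ℝ) (hψ : ContDiff ℝ (⊤ : ℕ∞) ψ) (hψper : ZnPeriodic ψ) :
    (∀ y, (Matrix.trace (S y * ((hessian n u y).map Complex.ofReal)⁻¹ *
        (hessian n ψ y).map Complex.ofReal)).im = 0) ∧
    HasDerivAt (fun t : ℝ => Fhat n (fun y => u y + t * ψ y) ξ)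
      (-(1/2) * ∫ y in Set.pi Set.univ (fun _ : Fin n => Set.Icc (0:ℝ) 1),
        (Matrix.trace (S y * ((hessian n u y).map Complex.ofReal)⁻¹ *
          (hessian n ψ y).map Complex.ofReal)).re) 0 := by
  have hu1 := hu.1
  have hpt := fun y => aux_dens_deriv (ξ y) (hessian n u y) (hessian n ψ y) (hξsym y)
    (aux_hess_symm ψ hψ y) (hu.2.2 y) (S y) (hSdiag y) (hSsq y)
  refine ⟨fun y => (hpt y).1, ?_⟩
  have hF : (fun t : ℝ => Fhat n (fun y => u y + t * ψ y) ξ) = fun t : ℝ =>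
      ∫ y in Set.pi Set.univ (fun _ : Fin n => Set.Icc (0:ℝ) 1),
        (fun p : ℝ × (Fin n → ℝ) => aux_dens (ξ p.2)
          (hessian n u p.2 + p.1 • hessian n ψ p.2)) (t, y) := by
    funext t
    simp only [Fhat, Mmat, aux_dens, aux_hess_add u ψ hu1 hψ]
  rw [hF, ← integral_const_mul]
  refine aux_integral (Set.pi Set.univ (fun _ : Fin n => Set.Icc (0:ℝ) 1))
    (isCompact_univ_pi fun _ => isCompact_Icc)
    (fun p : ℝ × (Fin n → ℝ) => aux_dens (ξ p.2) (hessian n u p.2 + p.1 • hessian n ψ p.2)) ?_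
    (fun y => -(1/2) * (Matrix.trace (S y * ((hessian n u y).map Complex.ofReal)⁻¹ *
          (hessian n ψ y).map Complex.ofReal)).re) ?_
  · intro y _
    have h0 : hessian n u y + (0 : ℝ) • hessian n ψ y = hessian n u y := by simp
    refine aux_dens_contDiffAt (fun p : ℝ × (Fin n → ℝ) => ξ p.2)
      (fun p => hessian n u p.2 + p.1 • hessian n ψ p.2) (0, y) ?_ ?_ (fun p => hξsym p.2) ?_ ?_
      (S y) (hSdiag y) ?_
    · intro i j
      exact (((hξsmooth i j).of_le (by simp)).comp contDiff_snd).contDiffAt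
    · intro i j
      have h1 : ContDiff ℝ 1 (fun p : ℝ × (Fin n → ℝ) => hessian n u p.2 i j) :=
        ((aux_hess_contDiff u hu1 i j).of_le (by simp)).comp contDiff_snd
      have h2 : ContDiff ℝ 1 (fun p : ℝ × (Fin n → ℝ) => hessian n ψ p.2 i j) :=
        ((aux_hess_contDiff ψ hψ i j).of_le (by simp)).comp contDiff_snd
      exact (h1.add (contDiff_fst.mul h2)).contDiffAt
    · intro p
      rw [Matrix.transpose_add, Matrix.transpose_smul, aux_hess_symm u hu1, aux_hess_symm ψ hψ]
    · simp only [h0]; exact hu.2.2 y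
    · simp only [h0]; exact hSsq y
  · intro y _
    exact (hpt y).2
end

section
/- Let n ≥ 1 and let ξ : ℝⁿ → Symₙ(ℂ) be a smooth ℤⁿ-periodic map. Let u₀, u₁ be periodic symplectic potentials such that for every t ∈ [0,1] the function u_t := (1−t)u₀ + t·u₁ is a periodic symplectic potential and the spectral radius of ξ(y)·D²u_t(y)·ξ̄(y)·D²u_t(y) is strictly less than 1 for all y ∈ ℝⁿ. Then the function [0,1] → ℝ, t ↦ F̂(u_t, ξ), is convex. -/
open MeasureTheory

noncomputable def hkKappa (θ : ℝ) : ℝ := Real.cos θ ^ 2 / (2 * Real.sin θ ^ 2)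

noncomputable def hkKer (x θ : ℝ) : ℝ := -(hkKappa θ * Real.log (1 - x * Real.sin θ ^ 2))

lemma hk_den_pos {x : ℝ} (hx : x < 1) (θ : ℝ) : 0 < 1 - x * Real.sin θ ^ 2 := by
  have h1 := Real.sin_sq_add_cos_sq θ
  have h2 := sq_nonneg (Real.sin θ)
  have h3 := sq_nonneg (Real.cos θ)
  rcases le_or_gt x 0 with h | h
  · nlinarith
  · nlinarith

lemma div_add_div_same_aux {D a : ℝ} (hD : D ≠ 0) :
    1 / (1 / (1 / (1 + a ^ 2 / D ^ 2))) = D ^ 2 / (D ^ 2 + a ^ 2) := by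
  have h1 : 1 + a ^ 2 / D ^ 2 = (D ^ 2 + a ^ 2) / D ^ 2 := by field_simp
  rw [h1]; simp

lemma hk_integral_aux {s : ℝ} (hs : 0 < s) :
    ∫ θ in (0:ℝ)..(Real.pi / 2), Real.cos θ ^ 2 / (1 - (1 - s ^ 2) * Real.sin θ ^ 2)
      = Real.pi / 2 / (1 + s) := by
  by_cases h1 : s = 1
  · subst h1
    simp [integral_cos_sq]
    ring
  have hne : 1 - s ≠ 0 := fun h => h1 (by linarith)
  have hden : ∀ θ : ℝ, 0 < 1 - (1 - s ^ 2) * Real.sin θ ^ 2 := fun θ =>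
    hk_den_pos (by nlinarith) θ
  have hD : ∀ θ : ℝ, 0 < Real.cos θ ^ 2 + s * Real.sin θ ^ 2 := fun θ => by
    have h1 := Real.sin_sq_add_cos_sq θ
    have h2 := sq_nonneg (Real.sin θ)
    have h3 := sq_nonneg (Real.cos θ)
    rcases le_or_gt s 1 with h | h <;> nlinarith
  have key : ∀ θ ∈ Set.uIcc (0:ℝ) (Real.pi/2), HasDerivAt
      (fun θ => (1 / (1 - s ^ 2)) * ((1 - s) * θ + s * Real.arctan
        ((1 - s) * (Real.sin θ * Real.cos θ) / (Real.cos θ ^ 2 + s * Real.sin θ ^ 2))))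
      (Real.cos θ ^ 2 / (1 - (1 - s ^ 2) * Real.sin θ ^ 2)) θ := by
    intro θ _
    have hs1 := Real.hasDerivAt_sin θ
    have hc1 := Real.hasDerivAt_cos θ
    have hq := (((hs1.mul hc1).const_mul (1 - s)).div
      ((hc1.pow 2).add ((hs1.pow 2).const_mul s)) (hD θ).ne').arctan
    have hf := (((hasDerivAt_id θ).const_mul (1 - s)).add (hq.const_mul s)).const_mul
      (1 / (1 - s ^ 2))
    refine hf.congr_deriv ?_
    have hsc := Real.sin_sq_add_cos_sq θ
    simp only [Pi.mul_apply, Pi.add_apply, Pi.pow_apply]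
    set S := Real.sin θ
    set C := Real.cos θ
    have hDp := hD θ
    have hdp := hden θ
    have hs2 : 1 - s ^ 2 ≠ 0 := by
      have : 1 - s ^ 2 = (1 - s) * (1 + s) := by ring
      rw [this]; exact mul_ne_zero hne (by positivity)
    have hsum : (C ^ 2 + s * S ^ 2) ^ 2 + ((1 - s) * (S * C)) ^ 2
        = 1 - (1 - s ^ 2) * S ^ 2 := by
      have : C ^ 2 = 1 - S ^ 2 := by linarith
      have h4 : ((1 - s) * (S * C)) ^ 2 = (1 - s) ^ 2 * S ^ 2 * C ^ 2 := by ring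
      rw [h4, this]; ring
    have hDp' : C ^ 2 + s * S ^ 2 ≠ 0 := hDp.ne'
    have hdp' : 1 - (1 - s ^ 2) * S ^ 2 ≠ 0 := hdp.ne'
    have harc : 1 / (1 + ((1 - s) * (S * C) / (C ^ 2 + s * S ^ 2)) ^ 2)
        = (C ^ 2 + s * S ^ 2) ^ 2 / (1 - (1 - s ^ 2) * S ^ 2) := by
      rw [← hsum]
      generalize C ^ 2 + s * S ^ 2 = D at hDp'
      rw [div_pow, ← div_add_div_same_aux hDp']; simp
    have hnum : ((1 - s) * (C * C + S * -S) * (C ^ 2 + s * S ^ 2) -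
                (1 - s) * (S * C) * (((2:ℕ):ℝ) * C ^ (2 - 1) * -S + s * (((2:ℕ):ℝ) * S ^ (2 - 1) * C)))
        = (1 - s) * (C ^ 2 - s * S ^ 2) := by
      have : C ^ 2 - s * S ^ 2 = (C ^ 2 - s * S ^ 2) * (S ^ 2 + C ^ 2) := by rw [hsc, mul_one]
      rw [this]; push_cast; ring
    rw [show ((fun y => (1 - s) * (Real.sin y * Real.cos y)) / (Real.cos ^ 2 + fun y => s * Real.sin y ^ 2)) θ = (1 - s) * (S * C) / (C ^ 2 + s * S ^ 2) from rfl, harc, hnum]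
    have hfin : (C ^ 2 + s * S ^ 2) ^ 2 / (1 - (1 - s ^ 2) * S ^ 2) *
        ((1 - s) * (C ^ 2 - s * S ^ 2) / (C ^ 2 + s * S ^ 2) ^ 2)
        = (1 - s) * (C ^ 2 - s * S ^ 2) / (1 - (1 - s ^ 2) * S ^ 2) := by
      generalize C ^ 2 + s * S ^ 2 = D at hDp'
      field_simp
    rw [hfin]
    rw [show C ^ 2 = 1 - S ^ 2 by linarith]
    generalize hd : 1 - (1 - s ^ 2) * S ^ 2 = d at hdp'
    field_simp
    rw [← hd]
    ring
  rw [intervalIntegral.integral_eq_sub_of_hasDerivAt key]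
  · simp
    have : 1 - s ^ 2 = (1 - s) * (1 + s) := by ring
    rw [this]
    field_simp
  · apply Continuous.intervalIntegrable
    exact (by fun_prop : Continuous fun θ : ℝ => Real.cos θ ^ 2).div (by fun_prop) (fun θ => (hden θ).ne')

lemma hkKer_meas (x : ℝ) : Measurable (hkKer x) := by
  unfold hkKer hkKappa
  fun_prop

lemma hkKer_hasDerivAt {x θ : ℝ} (hx : x < 1) (hθ : Real.sin θ ≠ 0) :
    HasDerivAt (fun x => hkKer x θ) (Real.cos θ ^ 2 / (2 * (1 - x * Real.sin θ ^ 2))) x := by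
  have h := hk_den_pos hx θ
  have h1 : HasDerivAt (fun x : ℝ => 1 - x * Real.sin θ ^ 2) (-(Real.sin θ ^ 2)) x := by
    simpa using ((hasDerivAt_id x).mul_const (Real.sin θ ^ 2)).const_sub 1
  have h2 := ((h1.log h.ne').const_mul (hkKappa θ)).neg
  refine h2.congr_deriv ?_
  unfold hkKappa
  field_simp

lemma hkKer_bound {x : ℝ} (hx : |x| < 1) (θ : ℝ) : |hkKer x θ| ≤ 1 / (1 - |x|) := by
  by_cases hθ : Real.sin θ = 0
  · have : 0 < 1 - |x| := by linarith
    simp [hkKer, hkKappa, hθ]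
    linarith
  have hx1 := (abs_lt.1 hx)
  have h := hk_den_pos hx1.2 θ
  have hss : 0 < Real.sin θ ^ 2 := by positivity
  have hsc := Real.sin_sq_add_cos_sq θ
  have hcc := sq_nonneg (Real.cos θ)
  have hax := abs_nonneg x
  have hle : 1 - |x| ≤ 1 - x * Real.sin θ ^ 2 := by
    have : x * Real.sin θ ^ 2 ≤ |x| := by
      have := le_abs_self x
      nlinarith
    linarith
  have hpos : 0 < 1 - |x| := by linarith
  have hl : |Real.log (1 - x * Real.sin θ ^ 2)| ≤ 2 * Real.sin θ ^ 2 / (1 - |x|) := by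
    have hu := Real.log_le_sub_one_of_pos h
    have hlow := Real.one_sub_inv_le_log_of_pos h
    have hi : (1 - x * Real.sin θ ^ 2)⁻¹ ≤ (1 - |x|)⁻¹ := inv_anti₀ hpos hle
    rw [abs_le]
    have h5 : 2 * Real.sin θ ^ 2 ≤ 2 * Real.sin θ ^ 2 / (1 - |x|) := by
      rw [le_div_iff₀ hpos]; nlinarith
    have hxx := neg_abs_le x
    constructor
    · have : 1 - (1 - x * Real.sin θ ^ 2)⁻¹ = -(x * Real.sin θ ^ 2) * (1 - x * Real.sin θ ^ 2)⁻¹ := by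
        field_simp; ring
      rw [this] at hlow
      have h7 : x * Real.sin θ ^ 2 * (1 - x * Real.sin θ ^ 2)⁻¹ ≤ 2 * Real.sin θ ^ 2 / (1 - |x|) := by
        have : 0 < (1 - x * Real.sin θ ^ 2)⁻¹ := by positivity
        rw [div_eq_mul_inv]
        apply mul_le_mul _ hi this.le (by positivity)
        nlinarith
      linarith
    · nlinarith
  unfold hkKer hkKappa
  rw [abs_neg, abs_mul, abs_of_nonneg (by positivity)]
  calc _ ≤ Real.cos θ ^ 2 / (2 * Real.sin θ ^ 2) * (2 * Real.sin θ ^ 2 / (1 - |x|)) := by gcongr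
    _ = Real.cos θ ^ 2 / (1 - |x|) := by field_simp
    _ ≤ _ := by gcongr; nlinarith

lemma hkKer_integrable {x : ℝ} (hx : |x| < 1) (a b : ℝ) :
    IntervalIntegrable (hkKer x) volume a b := by
  apply (intervalIntegrable_const (c := 1 / (1 - |x|))).mono_fun
  · exact (hkKer_meas x).aestronglyMeasurable
  · refine Filter.Eventually.of_forall fun θ => ?_
    simp only [Real.norm_eq_abs]
    exact (hkKer_bound hx θ).trans (le_abs_self _)

lemma hk_sin_ae : ∀ᵐ θ : ℝ, θ ∈ Set.uIoc (0:ℝ) (Real.pi/2) → Real.sin θ ≠ 0 := by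
  refine Filter.Eventually.of_forall fun θ hθ => ?_
  rw [Set.uIoc_of_le (by positivity)] at hθ
  exact (Real.sin_pos_of_pos_of_lt_pi hθ.1 (by linarith [hθ.2, Real.pi_pos])).ne'

lemma hk_int_deriv {x : ℝ} (hx : |x| < 1) :
    HasDerivAt (fun x => ∫ θ in (0:ℝ)..(Real.pi/2), hkKer x θ)
      (Real.pi / 4 / (1 + Real.sqrt (1 - x))) x := by
  obtain ⟨r, hr1, hr2⟩ := exists_between hx
  have hx1 := (abs_lt.1 hx)
  have hs : Set.Ioo (-r) r ∈ nhds x := Ioo_mem_nhds (by linarith [(abs_lt.1 hr1).1]) (abs_lt.1 hr1).2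
  have key := intervalIntegral.hasDerivAt_integral_of_dominated_loc_of_deriv_le
    (μ := volume) (a := 0) (b := Real.pi/2) (F := hkKer)
    (F' := fun x θ => Real.cos θ ^ 2 / (2 * (1 - x * Real.sin θ ^ 2))) (x₀ := x)
    (bound := fun _ => 1 / (2 * (1 - r))) hs
    (Filter.Eventually.of_forall fun x => (hkKer_meas x).aestronglyMeasurable)
    (hkKer_integrable hx _ _) (by
      apply Measurable.aestronglyMeasurable
      fun_prop)
    (Filter.Eventually.of_forall fun θ _ y hy => by
      have hy1 : y < 1 := hy.2.trans hr2
      have h := hk_den_pos hy1 θ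
      have hsc := Real.sin_sq_add_cos_sq θ
      have hcc := sq_nonneg (Real.cos θ)
      have hss := sq_nonneg (Real.sin θ)
      rw [Real.norm_eq_abs, abs_of_nonneg (by positivity)]
      have hr0 : 0 < r := by linarith [hy.1, hy.2]
      have : y * Real.sin θ ^ 2 ≤ r := by nlinarith [hy.2]
      apply div_le_div₀ zero_le_one (by nlinarith) (by linarith)
      linarith)
    intervalIntegrable_const
    (by
      filter_upwards [hk_sin_ae] with θ hθ hm y hy
      exact hkKer_hasDerivAt (hy.2.trans hr2) (hθ hm))
  refine key.2.congr_deriv ?_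
  have h := hk_integral_aux (s := Real.sqrt (1 - x)) (Real.sqrt_pos.2 (by linarith))
  rw [Real.sq_sqrt (by linarith)] at h
  have e : ∀ θ : ℝ, Real.cos θ ^ 2 / (2 * (1 - x * Real.sin θ ^ 2))
    = 2⁻¹ * (Real.cos θ ^ 2 / (1 - (1 - (1 - x)) * Real.sin θ ^ 2)) := fun θ => by
      rw [sub_sub_cancel, mul_comm 2, ← div_div]; ring
  simp_rw [e]
  rw [intervalIntegral.integral_const_mul, h]
  ring

lemma ftilde_deriv {x : ℝ} (hx : x < 1) :
    HasDerivAt ftilde (1 / (2 * (1 + Real.sqrt (1 - x)))) x := by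
  have hp : 0 < 1 - x := by linarith
  have hs := Real.sqrt_pos.2 hp
  have h1 : HasDerivAt (fun x => Real.sqrt (1 - x)) (-1 / (2 * Real.sqrt (1 - x))) x :=
    ((hasDerivAt_id x).const_sub 1).sqrt hp.ne'
  have h2 := ((h1.const_sub 1)).add
    ((((h1.const_add 1).div_const 2)).log (by positivity))
  refine h2.congr_deriv ?_
  field_simp
  ring

lemma ftilde_eq {x : ℝ} (hx : |x| < 1) :
    ftilde x = (2 / Real.pi) * ∫ θ in (0:ℝ)..(Real.pi/2), hkKer x θ := by
  have hd : ∀ y ∈ Set.Ioo (-1:ℝ) 1, HasDerivAt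
      (fun x => (2 / Real.pi) * ∫ θ in (0:ℝ)..(Real.pi/2), hkKer x θ)
      (1 / (2 * (1 + Real.sqrt (1 - y)))) y := fun y hy => by
    refine ((hk_int_deriv (abs_lt.2 hy)).const_mul (2 / Real.pi)).congr_deriv ?_
    have := Real.sqrt_nonneg (1 - y)
    field_simp
    norm_num
  refine isOpen_Ioo.eqOn_of_deriv_eq (s := Set.Ioo (-1:ℝ) 1) isPreconnected_Ioo
    (fun y hy => (ftilde_deriv hy.2).differentiableAt.differentiableWithinAt)
    (fun y hy => (hd y hy).differentiableAt.differentiableWithinAt)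
    (fun y hy => by rw [(ftilde_deriv hy.2).deriv, (hd y hy).deriv])
    (x := 0) (by simp) ?_ (abs_lt.1 hx)
  simp [ftilde, hkKer]

section HKMatrix
open Matrix
open scoped ComplexOrder

variable {m : Type*} [Fintype m] [DecidableEq m]

lemma hk_hasDerivAt_det (A0 A1 : Matrix m m ℂ) (t : ℝ) (ht : (A0 + (t:ℂ) • A1).det ≠ 0) :
    HasDerivAt (fun s : ℝ => (A0 + (s:ℂ) • A1).det)
      ((A0 + (t:ℂ) • A1).det * ((A0 + (t:ℂ) • A1)⁻¹ * A1).trace) t := by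
  set A := A0 + (t:ℂ) • A1 with hA
  set M := A⁻¹ * A1 with hM
  have hu : IsUnit A.det := isUnit_iff_ne_zero.2 ht
  set p : Polynomial ℂ :=
    (det (1 + (Polynomial.X : Polynomial ℂ) • M.map Polynomial.C)).divX.divX
  have hfun : (fun s : ℝ => (A0 + (s:ℂ) • A1).det) =
      fun s : ℝ => A.det * (1 + M.trace * ((s:ℂ) - t) + p.eval ((s:ℂ) - t) * ((s:ℂ) - t) ^ 2) := by
    funext s
    rw [← Matrix.det_one_add_smul, ← det_mul]
    congr 1
    rw [mul_add, mul_one, mul_smul_comm, hM, mul_nonsing_inv_cancel_left _ _ hu, hA, sub_smul]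
    abel
  rw [hfun]
  have hid : HasDerivAt (fun s : ℝ => (s:ℂ) - t) 1 t := by
    simpa using (Complex.ofRealCLM.hasDerivAt (x := t)).sub_const (t:ℂ)
  have hp : HasDerivAt (fun s : ℝ => p.eval ((s:ℂ) - t)) (p.derivative.eval 0 * 1) t := by
    have := p.hasDerivAt ((t:ℂ) - t)
    have h2 := HasDerivAt.comp t this hid
    rw [sub_self] at h2
    exact h2
  have := (((hid.const_mul M.trace).const_add 1).add (hp.mul (hid.pow 2))).const_mul A.det
  refine this.congr_deriv ?_
  simp

lemma hk_hasDerivAt_logdet (A0 A1 : Matrix m m ℂ) (t p : ℝ) (hp : 0 < p)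
    (ht : (A0 + (t:ℂ) • A1).det = p) :
    HasDerivAt (fun s : ℝ => Real.log (A0 + (s:ℂ) • A1).det.re)
      (((A0 + (t:ℂ) • A1)⁻¹ * A1).trace.re) t := by
  have h := hk_hasDerivAt_det A0 A1 t (by rw [ht]; exact_mod_cast hp.ne')
  have h1 : HasDerivAt (fun s : ℝ => ((A0 + (s:ℂ) • A1).det).re) _ t :=
    (Complex.reCLM.hasFDerivAt.comp_hasDerivAt t h)
  have h2 := h1.log (by rw [ht]; simpa using hp.ne')
  refine h2.congr_deriv ?_
  rw [ht]
  simp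
  field_simp

open scoped Matrix.Norms.Operator in
lemma hk_hasDerivAt_trace (A0 A1 : Matrix m m ℂ) (t : ℝ) (ht : (A0 + (t:ℂ) • A1).det ≠ 0) :
    HasDerivAt (fun s : ℝ => ((A0 + (s:ℂ) • A1)⁻¹ * A1).trace.re)
      (-(((A0 + (t:ℂ) • A1)⁻¹ * A1) * ((A0 + (t:ℂ) • A1)⁻¹ * A1)).trace.re) t := by
  have hu : IsUnit (A0 + (t:ℂ) • A1) := (Matrix.isUnit_iff_isUnit_det _).2 (isUnit_iff_ne_zero.2 ht)
  obtain ⟨u, hu⟩ := hu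
  have hpath : HasDerivAt (fun s : ℝ => A0 + (s:ℂ) • A1) A1 t := by
    have h1 : HasDerivAt (fun s : ℝ => (s:ℂ)) 1 t := Complex.ofRealCLM.hasDerivAt (x := t)
    have h2 := (h1.smul_const A1).const_add A0
    rw [one_smul] at h2
    exact h2
  have hinv := hasFDerivAt_ringInverse (𝕜 := ℝ) u
  rw [hu] at hinv
  have h2 := hinv.comp_hasDerivAt t hpath
  let T : Matrix m m ℂ →ₗ[ℝ] ℝ :=
    { toFun := fun M => (M * A1).trace.re
      map_add' := fun M N => by simp [add_mul]
      map_smul' := fun c M => by simp }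
  have h3 := (LinearMap.toContinuousLinearMap T).hasFDerivAt.comp_hasDerivAt t h2
  have e : (u⁻¹ : (Matrix m m ℂ)ˣ).val = (A0 + (t:ℂ) • A1)⁻¹ := by
    rw [← hu, Matrix.coe_units_inv]
  rw [e] at h3
  have e2 : (fun s : ℝ => ((A0 + (s:ℂ) • A1)⁻¹ * A1).trace.re) =
     (⇑(LinearMap.toContinuousLinearMap T) ∘ Ring.inverse ∘ fun s : ℝ => A0 + (s:ℂ) • A1) := by
    funext s
    simp [T, Matrix.nonsing_inv_eq_ringInverse]
  rw [e2]
  refine h3.congr_deriv ?_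
  change ((-((A0 + (t:ℂ) • A1)⁻¹ * A1 * (A0 + (t:ℂ) • A1)⁻¹)) * A1).trace.re = _
  rw [neg_mul, trace_neg, Complex.neg_re]
  simp only [mul_assoc]

/-- simultaneous diagonalization -/
lemma hk_diag {H X : Matrix m m ℂ} (hH : H.PosDef) (hX : X.IsHermitian) :
    ∃ (P Q : Matrix m m ℂ) (b : m → ℝ), P * Q = 1 ∧ Q * P = 1 ∧ H = P * Pᴴ ∧
      X = Qᴴ * diagonal (fun i => (b i : ℂ)) * Q := by
  obtain ⟨P0, Q0, h1, h2, h3⟩ : ∃ P0 Q0 : Matrix m m ℂ, P0 * Q0 = 1 ∧ Q0 * P0 = 1 ∧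
      H = P0 * P0ᴴ := by
    set U : Matrix m m ℂ := (hH.1.eigenvectorUnitary : Matrix m m ℂ) with hU
    have hUU : U * Uᴴ = 1 := Unitary.coe_mul_star_self hH.1.eigenvectorUnitary
    have hUU' : Uᴴ * U = 1 := Unitary.coe_star_mul_self hH.1.eigenvectorUnitary
    have hpos := hH.eigenvalues_pos
    have hs : H = U * diagonal (fun i => (hH.1.eigenvalues i : ℂ)) * Uᴴ := by
      have := hH.1.spectral_theorem
      rw [Unitary.conjStarAlgAut_apply] at this
      exact this
    set d := hH.1.eigenvalues
    set D := diagonal (fun i => ((Real.sqrt (d i) : ℝ) : ℂ)) with hD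
    set E := diagonal (fun i => (((Real.sqrt (d i))⁻¹ : ℝ) : ℂ)) with hE
    have hne : ∀ i, Real.sqrt (d i) ≠ 0 := fun i => (Real.sqrt_pos.2 (hpos i)).ne'
    have hDE : D * E = 1 := by
      rw [hD, hE, diagonal_mul_diagonal, ← diagonal_one]
      congr 1; funext i
      rw [← Complex.ofReal_mul, mul_inv_cancel₀ (hne i), Complex.ofReal_one]
    have hED : E * D = 1 := by
      rw [hD, hE, diagonal_mul_diagonal, ← diagonal_one]
      congr 1; funext i
      rw [← Complex.ofReal_mul, inv_mul_cancel₀ (hne i), Complex.ofReal_one]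
    have hDD : D * Dᴴ = diagonal (fun i => (d i : ℂ)) := by
      rw [hD, diagonal_conjTranspose, diagonal_mul_diagonal]
      congr 1; funext i
      simp only [Pi.star_apply, Complex.star_def, Complex.conj_ofReal]
      rw [← Complex.ofReal_mul, Real.mul_self_sqrt (hpos i).le]
    refine ⟨U * D, E * Uᴴ, ?_, ?_, ?_⟩
    · rw [show U * D * (E * Uᴴ) = U * (D * E) * Uᴴ by simp only [mul_assoc], hDE, mul_one, hUU]
    · rw [show E * Uᴴ * (U * D) = E * (Uᴴ * U) * D by simp only [mul_assoc], hUU', mul_one, hED]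
    · rw [conjTranspose_mul, show U * D * (Dᴴ * Uᴴ) = U * (D * Dᴴ) * Uᴴ by simp only [mul_assoc],
        hDD, ← hs]
  have hY : (P0ᴴ * X * P0).IsHermitian := isHermitian_conjTranspose_mul_mul P0 hX
  set U : Matrix m m ℂ := (hY.eigenvectorUnitary : Matrix m m ℂ) with hU
  have hUU : U * Uᴴ = 1 := Unitary.coe_mul_star_self hY.eigenvectorUnitary
  have hUU' : Uᴴ * U = 1 := Unitary.coe_star_mul_self hY.eigenvectorUnitary
  have hs : P0ᴴ * X * P0 = U * diagonal (fun i => (hY.eigenvalues i : ℂ)) * Uᴴ := by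
    have := hY.spectral_theorem
    rw [Unitary.conjStarAlgAut_apply] at this
    exact this
  refine ⟨P0 * U, Uᴴ * Q0, hY.eigenvalues, ?_, ?_, ?_, ?_⟩
  · rw [show P0 * U * (Uᴴ * Q0) = P0 * (U * Uᴴ) * Q0 by simp only [mul_assoc], hUU, mul_one, h1]
  · rw [show Uᴴ * Q0 * (P0 * U) = Uᴴ * (Q0 * P0) * U by simp only [mul_assoc], h2, mul_one, hUU']
  · rw [conjTranspose_mul, show P0 * U * (Uᴴ * P0ᴴ) = P0 * (U * Uᴴ) * P0ᴴ by simp only [mul_assoc],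
      hUU, mul_one, h3]
  · rw [conjTranspose_mul, conjTranspose_conjTranspose]
    have : Q0ᴴ * P0ᴴ = 1 := by rw [← conjTranspose_mul, h1, conjTranspose_one]
    calc X = (Q0ᴴ * P0ᴴ) * X * (P0 * Q0) := by rw [this, h1, one_mul, mul_one]
      _ = Q0ᴴ * (P0ᴴ * X * P0) * Q0 := by simp only [mul_assoc]
      _ = Q0ᴴ * (U * diagonal (fun i => (hY.eigenvalues i : ℂ)) * Uᴴ) * Q0 :=
        congrArg (fun Z => Q0ᴴ * Z * Q0) hs
      _ = _ := by simp only [mul_assoc]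

lemma hk_trace_sq {Q K : Matrix m m ℂ} (hK : K.IsHermitian) (r : m → ℝ) :
    ((Qᴴ * diagonal (fun i => (r i : ℂ)) * Q * K) *
      (Qᴴ * diagonal (fun i => (r i : ℂ)) * Q * K)).trace.re
      = ∑ i, ∑ j, r i * r j * ‖(Q * K * Qᴴ) i j‖ ^ 2 := by
  set L := Q * K * Qᴴ with hL
  have hLh : Lᴴ = L := by simp [hL, mul_assoc, hK.eq]
  set D := diagonal (fun i => (r i : ℂ))
  have e : ((Qᴴ * D * Q * K) * (Qᴴ * D * Q * K)).trace = ((D * L) * (D * L)).trace := by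
    have : (Qᴴ * D * Q * K) * (Qᴴ * D * Q * K) = Qᴴ * (D * L * D * Q * K) := by
      simp only [hL, mul_assoc]
    rw [this, trace_mul_comm]
    simp only [hL, mul_assoc]
  rw [e]
  simp only [Matrix.trace, Matrix.diag, Matrix.mul_apply (M := D * L), D, diagonal_mul,
    Complex.re_sum]
  refine Finset.sum_congr rfl fun i _ => Finset.sum_congr rfl fun j _ => ?_
  have hji : L j i = star (L i j) := by
    conv_lhs => rw [← hLh]
    rfl
  rw [hji]
  have : (r i : ℂ) * L i j * ((r j : ℂ) * star (L i j))
    = ((r i * r j * ‖L i j‖ ^ 2 : ℝ) : ℂ) := by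
    have h := Complex.mul_conj' (L i j)
    push_cast
    rw [← h]
    simp only [Complex.star_def]
    ring
  rw [this, Complex.ofReal_re]

lemma hk_scalar {μ a b : ℝ} (hμ : |μ| ≤ 1) (ha : |a| < 1) (hb : |b| < 1) :
    0 ≤ 1 + (1 - μ ^ 2) / (2 * μ ^ 2) * ((μ * a / (1 - μ * a)) * (μ * b / (1 - μ * b)) +
      ((-μ) * a / (1 - (-μ) * a)) * ((-μ) * b / (1 - (-μ) * b))) := by
  by_cases h0 : μ = 0
  · simp [h0]
  have ha' := abs_lt.1 ha
  have hb' := abs_lt.1 hb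
  have hl : μ ^ 2 ≤ 1 := (sq_le_one_iff_abs_le_one μ).2 hμ
  have ha2 : a ^ 2 < 1 := (sq_lt_one_iff_abs_lt_one a).2 ha
  have hb2 : b ^ 2 < 1 := (sq_lt_one_iff_abs_lt_one b).2 hb
  have hx : |μ * a| < 1 := by
    rw [abs_mul]; nlinarith [abs_nonneg μ, abs_nonneg a]
  have hy : |μ * b| < 1 := by
    rw [abs_mul]; nlinarith [abs_nonneg μ, abs_nonneg b]
  have hx' := abs_lt.1 hx
  have hy' := abs_lt.1 hy
  have h1 : 0 < 1 - μ * a := by linarith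
  have h2 : 0 < 1 - μ * b := by linarith
  have h3 : 0 < 1 + μ * a := by linarith
  have h4 : 0 < 1 + μ * b := by linarith
  have hp : |a * b| < 1 := by
    rw [abs_mul]; nlinarith [abs_nonneg b, abs_nonneg a]
  have hp' := abs_lt.1 hp
  have key : 1 + (1 - μ ^ 2) / (2 * μ ^ 2) * ((μ * a / (1 - μ * a)) * (μ * b / (1 - μ * b)) +
      ((-μ) * a / (1 - (-μ) * a)) * ((-μ) * b / (1 - (-μ) * b)))
      = ((1 - μ ^ 2 * a ^ 2) * (1 - μ ^ 2 * b ^ 2) + (1 - μ ^ 2) * (a * b) * (1 + μ ^ 2 * (a * b)))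
        / ((1 - μ * a) * (1 - μ * b) * ((1 + μ * a) * (1 + μ * b))) := by
    rw [show 1 - (-μ) * a = 1 + μ * a by ring, show 1 - (-μ) * b = 1 + μ * b by ring]
    field_simp
    ring
  rw [key]
  apply div_nonneg _ (by positivity)
  have h5 : a ^ 2 + b ^ 2 ≤ 1 + (a * b) ^ 2 := by nlinarith
  have h6 : 0 ≤ (1 - μ ^ 2) * (1 + a * b) := mul_nonneg (by linarith) (by linarith)
  nlinarith [mul_le_mul_of_nonneg_left h5 (sq_nonneg μ)]


lemma hk_diag_mul {P Q X H : Matrix m m ℂ} {b : m → ℝ} (hQP : Q * P = 1)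
    (hH : H = P * Pᴴ) (hX : X = Qᴴ * diagonal (fun i => (b i : ℂ)) * Q) :
    X * H = Qᴴ * diagonal (fun i => (b i : ℂ)) * Pᴴ := by
  rw [hX, hH, show Qᴴ * diagonal (fun i => (b i : ℂ)) * Q * (P * Pᴴ)
    = Qᴴ * diagonal (fun i => (b i : ℂ)) * (Q * P) * Pᴴ by simp only [mul_assoc], hQP, mul_one]

lemma hk_det_general {P Q X H : Matrix m m ℂ} {b : m → ℝ} (hPQ : P * Q = 1) (hQP : Q * P = 1)
    (hH : H = P * Pᴴ) (hX : X = Qᴴ * diagonal (fun i => (b i : ℂ)) * Q) (w : ℂ) :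
    (1 - w • (X * H)).det = ∏ i, (1 - w * b i) := by
  have h1 : Qᴴ * Pᴴ = 1 := by rw [← conjTranspose_mul, hPQ, conjTranspose_one]
  have h2 : 1 - w • (X * H) = Qᴴ * diagonal (fun i => 1 - w * b i) * Pᴴ := by
    have : diagonal (fun i => 1 - w * (b i:ℂ)) = 1 - w • diagonal (fun i => (b i : ℂ)) := by
      ext i j; by_cases h : i = j <;> simp [h, Matrix.one_apply, diagonal_apply]
    rw [this, hk_diag_mul hQP hH hX, mul_sub, sub_mul, mul_one, h1]
    simp
  rw [h2, det_mul, det_mul, det_diagonal, mul_right_comm, ← det_mul, h1, det_one, one_mul]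

lemma hk_inv_general {P Q X H : Matrix m m ℂ} {b : m → ℝ} (hPQ : P * Q = 1) (hQP : Q * P = 1)
    (hH : H = P * Pᴴ) (hX : X = Qᴴ * diagonal (fun i => (b i : ℂ)) * Q) (c : ℝ)
    (hc : ∀ i, 1 - c * b i ≠ 0) :
    (1 - (c:ℂ) • (X * H))⁻¹ * ((c:ℂ) • X) =
      Qᴴ * diagonal (fun i => ((c * b i / (1 - c * b i) : ℝ) : ℂ)) * Q := by
  have h1 : Qᴴ * Pᴴ = 1 := by rw [← conjTranspose_mul, hPQ, conjTranspose_one]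
  have h1' : Pᴴ * Qᴴ = 1 := by rw [← conjTranspose_mul, hQP, conjTranspose_one]
  have hdet : IsUnit (1 - (c:ℂ) • (X * H)).det := by
    rw [hk_det_general hPQ hQP hH hX, isUnit_iff_ne_zero]
    refine Finset.prod_ne_zero_iff.2 fun i _ => ?_
    exact_mod_cast hc i
  have key : (1 - (c:ℂ) • (X * H)) * (Qᴴ * diagonal (fun i => ((c * b i / (1 - c * b i) : ℝ) : ℂ)) * Q)
      = (c:ℂ) • X := by
    rw [hk_diag_mul hQP hH hX, sub_mul, one_mul, smul_mul_assoc]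
    rw [show Qᴴ * diagonal (fun i => (b i : ℂ)) * Pᴴ *
      (Qᴴ * diagonal (fun i => ((c * b i / (1 - c * b i) : ℝ) : ℂ)) * Q) =
      Qᴴ * (diagonal (fun i => (b i : ℂ)) * (Pᴴ * Qᴴ) *
        diagonal (fun i => ((c * b i / (1 - c * b i) : ℝ) : ℂ))) * Q by simp only [mul_assoc]]
    rw [h1', mul_one, diagonal_mul_diagonal, hX, ← smul_mul_assoc, ← mul_smul_comm, ← sub_mul,
      ← mul_sub, ← smul_mul_assoc, ← mul_smul_comm]
    congr 2
    ext i j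
    by_cases h : i = j
    · subst h
      simp only [Matrix.sub_apply, diagonal_apply_eq, Matrix.smul_apply, smul_eq_mul]
      have := hc i
      norm_cast
      field_simp
    · simp [h]
  rw [← key, nonsing_inv_mul_cancel_left _ _ hdet]

/-- `log det` of the Hermitian pencil is convex after adding the compensating term. -/
lemma hk_convex (H0 K X : Matrix m m ℂ) (hX : X.IsHermitian) (hK : K.IsHermitian)
    (hpos : ∀ t ∈ Set.Icc (0:ℝ) 1, (H0 + (t:ℂ) • K).PosDef)
    (hspec : ∀ t ∈ Set.Icc (0:ℝ) 1, ∀ b : ℝ, b ≠ 0 →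
      (1 - ((b⁻¹ : ℝ) : ℂ) • (X * (H0 + (t:ℂ) • K))).det = 0 → |b| < 1)
    (μ : ℝ) (hμ : |μ| ≤ 1) :
    ConvexOn ℝ (Set.Icc (0:ℝ) 1) (fun t =>
      -Real.log (H0 + (t:ℂ) • K).det.re - (1 - μ ^ 2) / (2 * μ ^ 2) *
        (Real.log (1 - (μ:ℂ) • (X * (H0 + (t:ℂ) • K))).det.re +
         Real.log (1 - ((-μ : ℝ):ℂ) • (X * (H0 + (t:ℂ) • K))).det.re)) := by
  have hdata : ∀ t ∈ Set.Icc (0:ℝ) 1, ∃ (P Q : Matrix m m ℂ) (b : m → ℝ), P * Q = 1 ∧ Q * P = 1 ∧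
      (H0 + (t:ℂ) • K) = P * Pᴴ ∧ X = Qᴴ * diagonal (fun i => (b i : ℂ)) * Q ∧ ∀ i, |b i| < 1 := by
    intro t ht
    obtain ⟨P, Q, b, h1, h2, h3, h4⟩ := hk_diag (hpos t ht) hX
    refine ⟨P, Q, b, h1, h2, h3, h4, fun i => ?_⟩
    by_cases h0 : b i = 0
    · simp [h0]
    · apply hspec t ht (b i) h0
      rw [hk_det_general h1 h2 h3 h4]
      refine Finset.prod_eq_zero (Finset.mem_univ i) ?_
      rw [← Complex.ofReal_mul, inv_mul_cancel₀ h0]; simp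
  have hcb : ∀ c b : ℝ, |c| ≤ 1 → |b| < 1 → 0 < 1 - c * b := by
    intro c b hc hb
    have : |c * b| < 1 := by rw [abs_mul]; nlinarith [abs_nonneg c, abs_nonneg b]
    linarith [(abs_lt.1 this).2]
  have hdet : ∀ c : ℝ, |c| ≤ 1 → ∀ t ∈ Set.Icc (0:ℝ) 1, ∃ p : ℝ, 0 < p ∧
      ((1 - (c:ℂ) • (X * H0)) + (t:ℂ) • (-((c:ℂ) • (X * K)))).det = p := by
    intro c hc t ht
    obtain ⟨P, Q, b, h1, h2, h3, h4, h5⟩ := hdata t ht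
    refine ⟨∏ i, (1 - c * b i), Finset.prod_pos fun i _ => hcb c _ hc (h5 i), ?_⟩
    rw [Complex.ofReal_prod]
    have := hk_det_general h1 h2 h3 h4 c
    push_cast
    rw [← this]
    congr 1
    rw [mul_add, mul_smul_comm]
    module
  have hdetH : ∀ t ∈ Set.Icc (0:ℝ) 1, ∃ p : ℝ, 0 < p ∧ (H0 + (t:ℂ) • K).det = p := by
    intro t ht
    have := (hpos t ht).det_pos
    rw [Complex.lt_def] at this
    exact ⟨_, this.1, Complex.ext rfl (by simpa using this.2.symm)⟩
  have hrw : ∀ c t : ℝ, 1 - (c:ℂ) • (X * (H0 + (t:ℂ) • K)) =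
      (1 - (c:ℂ) • (X * H0)) + (t:ℂ) • (-((c:ℂ) • (X * K))) := by
    intro c t
    rw [mul_add, mul_smul_comm]
    module
  have hμ' : |-μ| ≤ 1 := by rwa [abs_neg]
  have hd1 : ∀ c : ℝ, |c| ≤ 1 → ∀ t ∈ Set.Icc (0:ℝ) 1, HasDerivAt
      (fun t : ℝ => Real.log (1 - (c:ℂ) • (X * (H0 + (t:ℂ) • K))).det.re)
      ((((1 - (c:ℂ) • (X * H0)) + (t:ℂ) • (-((c:ℂ) • (X * K))))⁻¹ * (-((c:ℂ) • (X * K)))).trace.re) t := by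
    intro c hc t ht
    obtain ⟨p, hp, hp'⟩ := hdet c hc t ht
    simp_rw [hrw]
    exact hk_hasDerivAt_logdet _ _ t p hp hp'
  have hdH : ∀ t ∈ Set.Icc (0:ℝ) 1, HasDerivAt
      (fun t : ℝ => Real.log (H0 + (t:ℂ) • K).det.re)
      (((H0 + (t:ℂ) • K)⁻¹ * K).trace.re) t := by
    intro t ht
    obtain ⟨p, hp, hp'⟩ := hdetH t ht
    exact hk_hasDerivAt_logdet _ _ t p hp hp'
  have hf1 := fun t ht => ((hdH t ht).neg).sub
    (((hd1 μ hμ t ht).add (hd1 (-μ) hμ' t ht)).const_mul ((1 - μ ^ 2) / (2 * μ ^ 2)))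
  have hd2 : ∀ c : ℝ, |c| ≤ 1 → ∀ t ∈ Set.Icc (0:ℝ) 1, HasDerivAt _ _ t := fun c hc t ht =>
    hk_hasDerivAt_trace (1 - (c:ℂ) • (X * H0)) (-((c:ℂ) • (X * K))) t (by
      obtain ⟨p, hp, hp'⟩ := hdet c hc t ht
      rw [hp']; exact_mod_cast hp.ne')
  have hdH2 : ∀ t ∈ Set.Icc (0:ℝ) 1, HasDerivAt _ _ t := fun t ht =>
    hk_hasDerivAt_trace H0 K t (by
      obtain ⟨p, hp, hp'⟩ := hdetH t ht
      rw [hp']; exact_mod_cast hp.ne')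
  have hf2 := fun t ht => ((hdH2 t ht).neg).sub
    (((hd2 μ hμ t ht).add (hd2 (-μ) hμ' t ht)).const_mul ((1 - μ ^ 2) / (2 * μ ^ 2)))
  have hIntg : ∀ t ∈ interior (Set.Icc (0:ℝ) 1), t ∈ Set.Icc (0:ℝ) 1 := fun t ht =>
    interior_subset ht
  refine convexOn_of_hasDerivWithinAt2_nonneg (convex_Icc 0 1)
    (fun t ht => (hf1 t ht).continuousAt.continuousWithinAt)
    (fun t ht => (hf1 t (hIntg t ht)).hasDerivWithinAt)
    (fun t ht => (hf2 t (hIntg t ht)).hasDerivWithinAt) ?_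
  intro t ht
  obtain ⟨P, Q, b, h1, h2, h3, h4, h5⟩ := hdata t (hIntg t ht)
  have hQH : Pᴴ * Qᴴ = 1 := by rw [← conjTranspose_mul, h2, conjTranspose_one]
  have hHinv : (H0 + (t:ℂ) • K)⁻¹ = Qᴴ * diagonal (fun _ => ((1:ℝ) : ℂ)) * Q := by
    apply inv_eq_right_inv
    rw [h3]
    simp only [Complex.ofReal_one, diagonal_one, mul_one]
    rw [show P * Pᴴ * (Qᴴ * Q) = P * (Pᴴ * Qᴴ) * Q by simp only [mul_assoc], hQH, mul_one, h1]
  have hcinv : ∀ c : ℝ, |c| ≤ 1 →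
      ((1 - (c:ℂ) • (X * H0)) + (t:ℂ) • (-((c:ℂ) • (X * K))))⁻¹ * (-((c:ℂ) • (X * K))) =
      -(Qᴴ * diagonal (fun i => ((c * b i / (1 - c * b i) : ℝ) : ℂ)) * Q * K) := by
    intro c hc
    rw [← hk_inv_general h1 h2 h3 h4 c (fun i => (hcb c _ hc (h5 i)).ne'), ← hrw, mul_neg,
      mul_assoc, smul_mul_assoc]
  simp only [hcinv μ hμ, hcinv (-μ) hμ', hHinv, neg_mul_neg, hk_trace_sq hK]
  have : ∀ S T U k : ℝ, - -S - k * (-T + -U) = S + k * (T + U) := fun S T U k => by ring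
  rw [this]
  rw [mul_add, Finset.mul_sum, Finset.mul_sum, ← Finset.sum_add_distrib, ← Finset.sum_add_distrib]
  refine Finset.sum_nonneg fun i _ => ?_
  rw [Finset.mul_sum, Finset.mul_sum, ← Finset.sum_add_distrib, ← Finset.sum_add_distrib]
  refine Finset.sum_nonneg fun j _ => ?_
  have hs := mul_nonneg (hk_scalar hμ (h5 i) (h5 j)) (sq_nonneg ‖(Q * K * Qᴴ) i j‖)
  refine hs.trans (le_of_eq ?_)
  ring

end HKMatrix

section HKBlock
open Matrix
open scoped ComplexOrder

variable {n : ℕ}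

noncomputable def hkD (H : Matrix (Fin n) (Fin n) ℝ) : Matrix (Fin n ⊕ Fin n) (Fin n ⊕ Fin n) ℂ :=
  fromBlocks (H.map Complex.ofReal) 0 0 (H.map Complex.ofReal)

noncomputable def hkX (x : Matrix (Fin n) (Fin n) ℂ) : Matrix (Fin n ⊕ Fin n) (Fin n ⊕ Fin n) ℂ :=
  fromBlocks 0 x (x.map (starRingEnd ℂ)) 0

noncomputable def hkM (x : Matrix (Fin n) (Fin n) ℂ) (H : Matrix (Fin n) (Fin n) ℝ) :
    Matrix (Fin n) (Fin n) ℂ :=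
  x * H.map Complex.ofReal * x.map (starRingEnd ℂ) * H.map Complex.ofReal

lemma hkX_herm {x : Matrix (Fin n) (Fin n) ℂ} (hx : x.IsSymm) : (hkX x).IsHermitian := by
  unfold hkX
  rw [Matrix.IsHermitian, fromBlocks_conjTranspose]
  congr 1
  · simp
  · ext i j; simp [conjTranspose_apply, hx.apply]
  · ext i j; simp [conjTranspose_apply, hx.apply]
  · simp

lemma hkD_add (H K : Matrix (Fin n) (Fin n) ℝ) (t : ℝ) :
    hkD (H + t • K) = hkD H + (t:ℂ) • hkD K := by
  unfold hkD
  rw [fromBlocks_smul, fromBlocks_add]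
  congr 1
  · ext i j; simp
  · simp
  · simp
  · ext i j; simp

lemma hkD_herm {H : Matrix (Fin n) (Fin n) ℝ} (h : H.IsHermitian) : (hkD H).IsHermitian := by
  unfold hkD
  rw [Matrix.IsHermitian, fromBlocks_conjTranspose]
  have : (H.map Complex.ofReal)ᴴ = H.map Complex.ofReal := by
    ext i j
    have := h.apply i j
    simp only [star_trivial] at this
    simp [conjTranspose_apply, this]
  simp [this]

open scoped MatrixOrder Matrix.Norms.L2Operator in
lemma hk_posSemidef_factor {H : Matrix (Fin n) (Fin n) ℝ} (h : H.PosSemidef) :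
    ∃ B : Matrix (Fin n) (Fin n) ℝ, H = Bᴴ * B := by
  obtain ⟨B, hB⟩ := CStarAlgebra.nonneg_iff_eq_star_mul_self.mp h.nonneg
  exact ⟨B, hB⟩

lemma hkD_posDef {H : Matrix (Fin n) (Fin n) ℝ} (h : H.PosDef) : (hkD H).PosDef := by
  obtain ⟨B, hB, hBH⟩ : ∃ B : Matrix (Fin n) (Fin n) ℝ, IsUnit B.det ∧ H = Bᵀ * B := by
    have hd := h.det_pos
    obtain ⟨B, hB⟩ := hk_posSemidef_factor h.posSemidef
    refine ⟨B, ?_, by simpa using hB⟩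
    rw [hB, det_mul] at hd
    exact isUnit_iff_ne_zero.2 (right_ne_zero_of_mul hd.ne')
  have h2 : hkD H = (hkD B)ᴴ * hkD B := by
    unfold hkD
    rw [fromBlocks_conjTranspose, fromBlocks_multiply]
    have : H.map Complex.ofReal = (B.map Complex.ofReal)ᴴ * B.map Complex.ofReal := by
      ext i j
      rw [hBH]
      simp [Matrix.mul_apply]
    simp [this]
  rw [h2]
  apply Matrix.PosDef.conjTranspose_mul_self
  apply Matrix.mulVec_injective_of_isUnit
  rw [Matrix.isUnit_iff_isUnit_det]
  unfold hkD
  rw [det_fromBlocks_zero₂₁]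
  have : (B.map Complex.ofReal).det = (B.det : ℂ) := (Complex.ofRealHom.map_det B).symm
  rw [this]
  have : (B.det:ℂ) ≠ 0 := by exact_mod_cast hB.ne_zero
  exact isUnit_iff_ne_zero.2 (mul_ne_zero this this)

lemma hkD_det (H : Matrix (Fin n) (Fin n) ℝ) : (hkD H).det = ((H.det ^ 2 : ℝ) : ℂ) := by
  unfold hkD
  rw [det_fromBlocks_zero₂₁]
  have : (H.map Complex.ofReal).det = (H.det : ℂ) := (Complex.ofRealHom.map_det H).symm
  rw [this]; push_cast; ring

lemma hk_det_block (x : Matrix (Fin n) (Fin n) ℂ) (H : Matrix (Fin n) (Fin n) ℝ) (w : ℂ) :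
    (1 - w • (hkX x * hkD H)).det = (1 - w ^ 2 • hkM x H).det := by
  have : 1 - w • (hkX x * hkD H) = fromBlocks 1 (-(w • (x * H.map Complex.ofReal)))
      (-(w • (x.map (starRingEnd ℂ) * H.map Complex.ofReal))) 1 := by
    unfold hkX hkD
    rw [fromBlocks_multiply, fromBlocks_smul, ← fromBlocks_one, sub_eq_add_neg, fromBlocks_neg,
      fromBlocks_add]
    simp
  rw [this, det_fromBlocks_one₂₂]
  congr 2
  unfold hkM
  rw [neg_mul_neg, smul_mul_smul_comm, pow_two]
  simp only [mul_assoc]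

lemma hk_eval_charpoly (M : Matrix (Fin n) (Fin n) ℂ) {z : ℂ} (hz : z ≠ 0) :
    M.charpoly.eval z = z ^ n * (1 - z⁻¹ • M).det := by
  rw [Matrix.eval_charpoly]
  have : Matrix.scalar (Fin n) z - M = z • (1 - z⁻¹ • M) := by
    rw [smul_sub, smul_smul, mul_inv_cancel₀ hz, one_smul]
    congr 1
    ext i j; simp [Matrix.one_apply, Matrix.diagonal_apply]
  rw [this, det_smul, Fintype.card_fin]

lemma hk_det_roots (M : Matrix (Fin n) (Fin n) ℂ) (l : ℂ) :
    (1 - l • M).det = (M.charpoly.roots.map fun z => 1 - l * z).prod := by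
  by_cases hl : l = 0
  · simp [hl]
  have hs := (IsAlgClosed.splits M.charpoly)
  have hc : M.charpoly.roots.card = n := by
    rw [← hs.natDegree_eq_card_roots, charpoly_natDegree_eq_dim, Fintype.card_fin]
  have h1 := hk_eval_charpoly M (inv_ne_zero hl)
  rw [inv_inv] at h1
  have h2 : (1 - l • M).det = l ^ n * M.charpoly.eval l⁻¹ := by
    rw [h1, ← mul_assoc, ← mul_pow, mul_inv_cancel₀ hl, one_pow, one_mul]
  have h3 : M.charpoly.eval l⁻¹ = (M.charpoly.roots.map fun z => l⁻¹ - z).prod := by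
    conv_lhs => rw [hs.eq_prod_roots_of_monic (charpoly_monic M)]
    rw [Polynomial.eval_multiset_prod, Multiset.map_map]
    simp
  rw [h2, h3]
  have h4 : l ^ n = (M.charpoly.roots.map fun _ => l).prod := by
    rw [Multiset.map_const', Multiset.prod_replicate, hc]
  rw [h4, ← Multiset.prod_map_mul]
  congr 1
  apply Multiset.map_congr rfl
  intro z _
  rw [mul_sub, mul_inv_cancel₀ hl]

lemma hk_root_of_det {M : Matrix (Fin n) (Fin n) ℂ} {z : ℂ} (hz : z ≠ 0) :
    z ∈ M.charpoly.roots ↔ (1 - z⁻¹ • M).det = 0 := by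
  rw [Polynomial.mem_roots (charpoly_monic M).ne_zero, Polynomial.IsRoot.def, hk_eval_charpoly M hz]
  simp [hz]

/-- eigenvalues of `ξ H ξ̄ H` are real in `[0,1)` -/
lemma hk_roots_real {x : Matrix (Fin n) (Fin n) ℂ} {H : Matrix (Fin n) (Fin n) ℝ}
    (hx : x.IsSymm) (hH : H.PosDef) (hs : ∀ z ∈ spectrum ℂ (hkM x H), ‖z‖ < 1)
    {z : ℂ} (hz : z ∈ (hkM x H).charpoly.roots) :
    z = (z.re : ℂ) ∧ 0 ≤ z.re ∧ z.re < 1 := by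
  have hn : ‖z‖ < 1 := by
    apply hs
    rw [Matrix.mem_spectrum_iff_isRoot_charpoly]
    exact (Polynomial.mem_roots'.1 hz).2
  have hlt : z.re < 1 := (le_abs_self _).trans_lt ((Complex.abs_re_le_norm z).trans_lt hn)
  by_cases h0 : z = 0
  · simp [h0]
  rw [hk_root_of_det h0] at hz
  obtain ⟨w, hw⟩ : ∃ w : ℂ, z = w ^ 2 := ⟨z ^ (1/2 : ℂ), by
    rw [← Complex.cpow_nat_mul]; simp⟩
  have hw0 : w ≠ 0 := by rintro rfl; simp at hw; exact h0 hw
  rw [hw, ← inv_pow, ← hk_det_block] at hz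
  obtain ⟨P, Q, b, h1, h2, h3, h4⟩ := hk_diag (hkD_posDef hH) (hkX_herm hx)
  rw [hk_det_general h1 h2 h3 h4, Finset.prod_eq_zero_iff] at hz
  obtain ⟨i, -, hi⟩ := hz
  have : w = b i := by
    field_simp at hi
    rw [mul_zero] at hi
    exact sub_eq_zero.1 hi
  have hzz : z = ((b i ^ 2 : ℝ) : ℂ) := by rw [hw, this]; push_cast; rfl
  refine ⟨by rw [hzz, Complex.ofReal_re], ?_, hlt⟩
  rw [hzz, Complex.ofReal_re]; positivity

lemma hk_spec {x : Matrix (Fin n) (Fin n) ℂ} {H : Matrix (Fin n) (Fin n) ℝ}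
    (hs : ∀ z ∈ spectrum ℂ (hkM x H), ‖z‖ < 1) {b : ℝ} (hb : b ≠ 0)
    (hd : (1 - ((b⁻¹ : ℝ) : ℂ) • (hkX x * hkD H)).det = 0) : |b| < 1 := by
  rw [hk_det_block] at hd
  have h1 : ((b:ℂ) ^ 2) ≠ 0 := by simpa using hb
  have : ((b:ℂ) ^ 2) ∈ spectrum ℂ (hkM x H) := by
    rw [Matrix.mem_spectrum_iff_isRoot_charpoly]
    refine (Polynomial.mem_roots'.1 ((hk_root_of_det h1).2 ?_)).2
    rw [← hd]; simp
  have := hs _ this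
  rw [norm_pow, Complex.norm_real, Real.norm_eq_abs] at this
  have h0 := abs_nonneg b
  by_contra hcon
  push Not at hcon
  nlinarith

/-- `log det (1 - l M)` as a sum over roots -/
lemma hk_logdet_roots {x : Matrix (Fin n) (Fin n) ℂ} {H : Matrix (Fin n) (Fin n) ℝ}
    (hx : x.IsSymm) (hH : H.PosDef) (hs : ∀ z ∈ spectrum ℂ (hkM x H), ‖z‖ < 1) (θ : ℝ) :
    Real.log (1 - ((Real.sin θ ^ 2 : ℝ) : ℂ) • hkM x H).det.re =
      ((hkM x H).charpoly.roots.map fun z => Real.log (1 - z.re * Real.sin θ ^ 2)).sum := by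
  rw [hk_det_roots]
  have h1 : ((hkM x H).charpoly.roots.map fun z => 1 - ((Real.sin θ ^ 2 : ℝ) : ℂ) * z) =
      (((hkM x H).charpoly.roots.map fun z => 1 - z.re * Real.sin θ ^ 2).map Complex.ofReal) := by
    rw [Multiset.map_map]
    apply Multiset.map_congr rfl
    intro z hz
    have := (hk_roots_real hx hH hs hz).1
    simp only [Function.comp]
    conv_lhs => rw [this]
    push_cast; ring
  rw [h1]
  have h2 := (map_multiset_prod Complex.ofRealHom
    ((hkM x H).charpoly.roots.map fun z => 1 - z.re * Real.sin θ ^ 2))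
  have h3 : (Multiset.map (Complex.ofReal) ((hkM x H).charpoly.roots.map
    fun z => 1 - z.re * Real.sin θ ^ 2)).prod = (((hkM x H).charpoly.roots.map
    fun z => 1 - z.re * Real.sin θ ^ 2).prod : ℝ) := h2.symm
  rw [h3, Complex.ofReal_re, Real.log_multiset_prod, Multiset.map_map]
  · rfl
  · intro r hr
    obtain ⟨z, hz, rfl⟩ := Multiset.mem_map.1 hr
    exact (hk_den_pos (hk_roots_real hx hH hs hz).2.2 θ).ne'

noncomputable def hkG (x : Matrix (Fin n) (Fin n) ℂ) (H : Matrix (Fin n) (Fin n) ℝ) (θ : ℝ) : ℝ :=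
  -(hkKappa θ * Real.log (1 - ((Real.sin θ ^ 2 : ℝ) : ℂ) • hkM x H).det.re)

lemma hkG_eq {x : Matrix (Fin n) (Fin n) ℂ} {H : Matrix (Fin n) (Fin n) ℝ}
    (hx : x.IsSymm) (hH : H.PosDef) (hs : ∀ z ∈ spectrum ℂ (hkM x H), ‖z‖ < 1) (θ : ℝ) :
    hkG x H θ = ((hkM x H).charpoly.roots.map fun z => hkKer z.re θ).sum := by
  unfold hkG
  rw [hk_logdet_roots hx hH hs]
  unfold hkKer
  rw [Multiset.sum_map_neg, Multiset.sum_map_mul_left]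

lemma hk_multiset_int (s : Multiset ℂ) (hs : ∀ z ∈ s, |z.re| < 1) :
    IntervalIntegrable (fun θ => (s.map fun z => hkKer z.re θ).sum) volume 0 (Real.pi / 2) ∧
    (s.map fun z => ftilde z.re).sum =
      (2 / Real.pi) * ∫ θ in (0:ℝ)..(Real.pi / 2), (s.map fun z => hkKer z.re θ).sum := by
  induction s using Multiset.induction with
  | empty => simp
  | cons a s ih =>
    obtain ⟨h1, h2⟩ := ih (fun z hz => hs z (Multiset.mem_cons_of_mem hz))
    have ha := hs a (Multiset.mem_cons_self a s)
    simp only [Multiset.map_cons, Multiset.sum_cons]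
    refine ⟨(hkKer_integrable ha _ _).add h1, ?_⟩
    rw [intervalIntegral.integral_add (hkKer_integrable ha _ _) h1, h2, ftilde_eq ha, mul_add]

lemma hkG_int {x : Matrix (Fin n) (Fin n) ℂ} {H : Matrix (Fin n) (Fin n) ℝ}
    (hx : x.IsSymm) (hH : H.PosDef) (hs : ∀ z ∈ spectrum ℂ (hkM x H), ‖z‖ < 1) :
    IntervalIntegrable (hkG x H) volume 0 (Real.pi / 2) ∧
    rhoFn (hkM x H) = (2 / Real.pi) * ∫ θ in (0:ℝ)..(Real.pi / 2), hkG x H θ := by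
  have h : hkG x H = fun θ => ((hkM x H).charpoly.roots.map fun z => hkKer z.re θ).sum := by
    funext θ; exact hkG_eq hx hH hs θ
  rw [h]
  apply hk_multiset_int
  intro z hz
  obtain ⟨-, h1, h2⟩ := hk_roots_real hx hH hs hz
  rw [abs_of_nonneg h1]; exact h2

/-- pointwise convexity -/
lemma hk_pointwise {x : Matrix (Fin n) (Fin n) ℂ} {H0 K : Matrix (Fin n) (Fin n) ℝ}
    (hx : x.IsSymm) (hK : K.IsHermitian)
    (hH : ∀ t ∈ Set.Icc (0:ℝ) 1, (H0 + t • K).PosDef)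
    (hs : ∀ t ∈ Set.Icc (0:ℝ) 1, ∀ z ∈ spectrum ℂ (hkM x (H0 + t • K)), ‖z‖ < 1) :
    ConvexOn ℝ (Set.Icc (0:ℝ) 1) (fun t =>
      -(1/2) * Real.log (H0 + t • K).det + (1/2) * rhoFn (hkM x (H0 + t • K))) := by
  have hθ : ∀ θ : ℝ, ConvexOn ℝ (Set.Icc (0:ℝ) 1) (fun t =>
      -Real.log (H0 + t • K).det + hkG x (H0 + t • K) θ) := by
    intro θ
    have h := hk_convex (hkD H0) (hkD K) (hkX x) (hkX_herm hx) (hkD_herm hK)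
      (fun t ht => by rw [← hkD_add]; exact hkD_posDef (hH t ht))
      (fun t ht b hb hd => by rw [← hkD_add] at hd; exact hk_spec (hs t ht) hb hd)
      (Real.sin θ) (Real.abs_sin_le_one θ)
    have h2 := h.smul (c := 1/2) (by norm_num)
    refine h2.congr ?_
    intro t ht
    simp only [← hkD_add, hk_det_block, hkD_det, hkG, hkKappa, smul_eq_mul, Complex.ofReal_re,
      Real.log_pow]
    have e1 : ((Real.sin θ : ℝ) : ℂ) ^ 2 = ((Real.sin θ ^ 2 : ℝ) : ℂ) := by push_cast; rfl
    have e2 : (((-Real.sin θ) : ℝ) : ℂ) ^ 2 = ((Real.sin θ ^ 2 : ℝ) : ℂ) := by push_cast; ring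
    rw [e1, e2, ← Real.cos_sq']
    push_cast
    ring
  refine ⟨convex_Icc 0 1, ?_⟩
  intro t1 ht1 t2 ht2 a b ha hb hab
  have ht3 := (convex_Icc (0:ℝ) 1) ht1 ht2 ha hb hab
  obtain ⟨i1, r1⟩ := hkG_int hx (hH _ ht1) (hs _ ht1)
  obtain ⟨i2, r2⟩ := hkG_int hx (hH _ ht2) (hs _ ht2)
  obtain ⟨i3, r3⟩ := hkG_int hx (hH _ ht3) (hs _ ht3)
  have hpi := Real.pi_pos
  have key : ∫ θ in (0:ℝ)..(Real.pi / 2), (-Real.log (H0 + (a • t1 + b • t2) • K).det +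
        hkG x (H0 + (a • t1 + b • t2) • K) θ) ≤
      ∫ θ in (0:ℝ)..(Real.pi / 2), (a * (-Real.log (H0 + t1 • K).det + hkG x (H0 + t1 • K) θ) +
        b * (-Real.log (H0 + t2 • K).det + hkG x (H0 + t2 • K) θ)) := by
    apply intervalIntegral.integral_mono_on (by positivity)
    · exact intervalIntegrable_const.add i3
    · exact ((intervalIntegrable_const.add i1).const_mul a).add
        ((intervalIntegrable_const.add i2).const_mul b)
    · intro θ _
      have := (hθ θ).2 ht1 ht2 ha hb hab
      simpa only [smul_eq_mul] using this
  rw [intervalIntegral.integral_add intervalIntegrable_const i3,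
    intervalIntegral.integral_add ((intervalIntegrable_const.add i1).const_mul a)
        ((intervalIntegrable_const.add i2).const_mul b),
    intervalIntegral.integral_const_mul, intervalIntegral.integral_const_mul,
    intervalIntegral.integral_add intervalIntegrable_const i1,
    intervalIntegral.integral_add intervalIntegrable_const i2] at key
  simp only [intervalIntegral.integral_const, sub_zero] at key
  have key2 := mul_le_mul_of_nonneg_left key (show 0 ≤ (1 / Real.pi) by positivity)
  simp only [r1, r2, r3]
  simp only [smul_eq_mul] at key2 ⊢
  refine le_trans (le_of_eq ?_) (key2.trans (le_of_eq ?_))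
  · field_simp
  · field_simp

end HKBlock

section HKAnalysis
open Matrix

lemma hk_contDiff_fderiv {n : ℕ} {u : (Fin n → ℝ) → ℝ} (hu : ContDiff ℝ (⊤ : ℕ∞) u)
    (v : Fin n → ℝ) : ContDiff ℝ 1 (fun z => fderiv ℝ u z v) := by
  have h : ContDiff ℝ 1 (fderiv ℝ u) := by
    refine hu.fderiv_right (m := 1) ?_
    have : ((1 + 1 : ℕ∞) : WithTop ℕ∞) ≤ ((⊤ : ℕ∞) : WithTop ℕ∞) :=
      WithTop.coe_le_coe.2 le_top
    exact this
  exact h.clm_apply contDiff_const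

lemma hk_hessian_cont {n : ℕ} {u : (Fin n → ℝ) → ℝ} (hu : ContDiff ℝ (⊤ : ℕ∞) u) :
    Continuous (hessian n u) := by
  apply continuous_matrix
  intro i j
  have h := (hk_contDiff_fderiv hu (Pi.single j 1)).continuous_fderiv (by norm_num)
  exact h.clm_apply continuous_const

lemma hk_hessian_path {n : ℕ} {u₀ u₁ : (Fin n → ℝ) → ℝ} (h0 : ContDiff ℝ (⊤ : ℕ∞) u₀)
    (h1 : ContDiff ℝ (⊤ : ℕ∞) u₁) (t : ℝ) (y : Fin n → ℝ) :
    hessian n (fun y => (1 - t) * u₀ y + t * u₁ y) y =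
      hessian n u₀ y + t • (hessian n u₁ y - hessian n u₀ y) := by
  have d0 : Differentiable ℝ u₀ := h0.differentiable (by simp)
  have d1 : Differentiable ℝ u₁ := h1.differentiable (by simp)
  ext i j
  have e : (fun z => fderiv ℝ (fun y => (1 - t) * u₀ y + t * u₁ y) z (Pi.single j 1)) =
      fun z => (1 - t) * fderiv ℝ u₀ z (Pi.single j 1) + t * fderiv ℝ u₁ z (Pi.single j 1) := by
    funext z
    rw [fderiv_fun_add ((d0 z).const_mul _) ((d1 z).const_mul _), fderiv_const_mul (d0 z),
      fderiv_const_mul (d1 z)]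
    simp
  have c0 := ((hk_contDiff_fderiv h0 (Pi.single j 1)).differentiable (by norm_num)) y
  have c1 := ((hk_contDiff_fderiv h1 (Pi.single j 1)).differentiable (by norm_num)) y
  simp only [hessian, Matrix.of_apply, e, Matrix.add_apply, Matrix.smul_apply, Matrix.sub_apply]
  rw [fderiv_fun_add (c0.const_mul _) (c1.const_mul _), fderiv_const_mul c0, fderiv_const_mul c1]
  simp
  ring

lemma hk_ftilde_bound {x : ℝ} (h0 : 0 ≤ x) : |ftilde x| ≤ 1 := by
  unfold ftilde
  set s := Real.sqrt (1 - x) with hs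
  have s0 : 0 ≤ s := Real.sqrt_nonneg _
  have s1 : s ≤ 1 := Real.sqrt_le_one.2 (by linarith)
  have l1 : Real.log ((1 + s) / 2) ≤ 0 := Real.log_nonpos (by linarith) (by linarith)
  have l2 := Real.one_sub_inv_le_log_of_pos (show 0 < (1 + s) / 2 by linarith)
  have l3 : ((1 + s) / 2)⁻¹ ≤ 2 := by
    rw [inv_le_comm₀ (by linarith) (by norm_num)]; linarith
  rw [abs_le]; constructor <;> linarith

lemma hk_multiset_abs (s : Multiset ℂ) (hs : ∀ z ∈ s, 0 ≤ z.re) :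
    |(s.map fun z => ftilde z.re).sum| ≤ s.card := by
  induction s using Multiset.induction with
  | empty => simp
  | cons a s ih =>
    have h1 := ih (fun z hz => hs z (Multiset.mem_cons_of_mem hz))
    have h2 := hk_ftilde_bound (hs a (Multiset.mem_cons_self a s))
    simp only [Multiset.map_cons, Multiset.sum_cons, Multiset.card_cons]
    push_cast
    refine (abs_add_le _ _).trans (by linarith)

lemma hk_rho_bound {n : ℕ} {x : Matrix (Fin n) (Fin n) ℂ} {H : Matrix (Fin n) (Fin n) ℝ}
    (hx : x.IsSymm) (hH : H.PosDef) (hs : ∀ z ∈ spectrum ℂ (hkM x H), ‖z‖ < 1) :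
    |rhoFn (hkM x H)| ≤ n := by
  refine (hk_multiset_abs _ fun z hz => (hk_roots_real hx hH hs hz).2.1).trans ?_
  have := Polynomial.card_roots' (hkM x H).charpoly
  rw [charpoly_natDegree_eq_dim, Fintype.card_fin] at this
  exact_mod_cast this

lemma hk_rho_meas {n : ℕ} {ξ : (Fin n → ℝ) → Matrix (Fin n) (Fin n) ℂ}
    {H : (Fin n → ℝ) → Matrix (Fin n) (Fin n) ℝ} (hξ : Continuous ξ) (hH : Continuous H)
    (hx : ∀ y, (ξ y).IsSymm) (hp : ∀ y, (H y).PosDef)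
    (hs : ∀ y, ∀ z ∈ spectrum ℂ (hkM (ξ y) (H y)), ‖z‖ < 1) :
    StronglyMeasurable (fun y => rhoFn (hkM (ξ y) (H y))) := by
  have e : (fun y => rhoFn (hkM (ξ y) (H y))) = fun y => (2 / Real.pi) *
      ∫ θ in Set.Ioc (0:ℝ) (Real.pi / 2), hkG (ξ y) (H y) θ := by
    funext y
    rw [(hkG_int (hx y) (hp y) (hs y)).2, intervalIntegral.integral_of_le (by positivity)]
  rw [e]
  apply StronglyMeasurable.const_mul
  apply StronglyMeasurable.integral_prod_right
  apply Measurable.stronglyMeasurable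
  have hM : Continuous (fun y => hkM (ξ y) (H y)) := by
    unfold hkM
    have h1 : Continuous fun y => (H y).map Complex.ofReal :=
      hH.matrix_map Complex.continuous_ofReal
    have h2 : Continuous fun y => (ξ y).map (starRingEnd ℂ) :=
      hξ.matrix_map Complex.continuous_conj
    exact ((hξ.matrix_mul h1).matrix_mul h2).matrix_mul h1
  have hc : Continuous (fun p : (Fin n → ℝ) × ℝ =>
      (1 - ((Real.sin p.2 ^ 2 : ℝ) : ℂ) • hkM (ξ p.1) (H p.1)).det.re) := by
    apply Complex.continuous_re.comp
    apply Continuous.matrix_det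
    apply continuous_const.sub
    have h1 : Continuous (fun p : (Fin n → ℝ) × ℝ => ((Real.sin p.2 ^ 2 : ℝ) : ℂ)) := by fun_prop
    exact h1.smul (hM.comp continuous_fst)
  have hk : Measurable hkKappa := by unfold hkKappa; fun_prop
  unfold Function.uncurry hkG
  exact ((hk.comp measurable_snd).mul (Real.measurable_log.comp hc.measurable)).neg

lemma hk_integrable {n : ℕ} {ξ : (Fin n → ℝ) → Matrix (Fin n) (Fin n) ℂ}
    {H : (Fin n → ℝ) → Matrix (Fin n) (Fin n) ℝ} (hξ : Continuous ξ) (hH : Continuous H)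
    (hx : ∀ y, (ξ y).IsSymm) (hp : ∀ y, (H y).PosDef)
    (hs : ∀ y, ∀ z ∈ spectrum ℂ (hkM (ξ y) (H y)), ‖z‖ < 1) :
    IntegrableOn (fun y => -(1/2) * Real.log (H y).det + (1/2) * rhoFn (hkM (ξ y) (H y)))
      (Set.pi Set.univ (fun _ : Fin n => Set.Icc (0:ℝ) 1)) := by
  have hcomp : IsCompact (Set.pi Set.univ (fun _ : Fin n => Set.Icc (0:ℝ) 1)) :=
    isCompact_univ_pi fun _ => isCompact_Icc
  have h1 : IntegrableOn (fun y => Real.log (H y).det)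
      (Set.pi Set.univ (fun _ : Fin n => Set.Icc (0:ℝ) 1)) :=
    ((hH.matrix_det).log fun y => (hp y).det_pos.ne').continuousOn.integrableOn_compact hcomp
  have h2 : IntegrableOn (fun y => rhoFn (hkM (ξ y) (H y)))
      (Set.pi Set.univ (fun _ : Fin n => Set.Icc (0:ℝ) 1)) := by
    refine Measure.integrableOn_of_bounded (M := n) hcomp.measure_lt_top.ne
      (hk_rho_meas hξ hH hx hp hs).aestronglyMeasurable ?_
    filter_upwards with y
    rw [Real.norm_eq_abs]
    exact hk_rho_bound (hx y) (hp y) (hs y)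
  exact (Integrable.const_mul h1 _).add (Integrable.const_mul h2 _)

end HKAnalysis

/-- the periodic HK-energy is convex along linear paths of periodic
symplectic potentials staying in the admissible locus. -/
theorem statement7 (n : ℕ) (hn : 1 ≤ n)
    (ξ : (Fin n → ℝ) → Matrix (Fin n) (Fin n) ℂ)
    (hξsmooth : ∀ a b, ContDiff ℝ (⊤ : ℕ∞) fun y => ξ y a b)
    (hξper : ZnPeriodic ξ)
    (hξsym : ∀ y, (ξ y).IsSymm)
    (u₀ u₁ : (Fin n → ℝ) → ℝ)
    (hu₀ : IsSymplecticPotential n u₀) (hu₁ : IsSymplecticPotential n u₁)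
    (hpath : ∀ t ∈ Set.Icc (0:ℝ) 1,
      IsSymplecticPotential n (fun y => (1 - t) * u₀ y + t * u₁ y) ∧
      ∀ y, ∀ μ ∈ spectrum ℂ (Mmat n ξ (fun y => (1 - t) * u₀ y + t * u₁ y) y), ‖μ‖ < 1) :
    ConvexOn ℝ (Set.Icc (0:ℝ) 1)
      (fun t => Fhat n (fun y => (1 - t) * u₀ y + t * u₁ y) ξ) := by
  have hξc : Continuous ξ := continuous_matrix fun i j => (hξsmooth i j).continuous
  have hpw : ∀ y, ConvexOn ℝ (Set.Icc (0:ℝ) 1) (fun t =>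
      -(1/2) * Real.log (hessian n (fun y => (1 - t) * u₀ y + t * u₁ y) y).det +
        (1/2) * rhoFn (hkM (ξ y) (hessian n (fun y => (1 - t) * u₀ y + t * u₁ y) y))) := by
    intro y
    simp only [hk_hessian_path hu₀.1 hu₁.1]
    refine hk_pointwise (hξsym y) ((hu₁.2.2 y).1.sub (hu₀.2.2 y).1) ?_ ?_
    · intro t ht
      have := (hpath t ht).1.2.2 y
      rwa [hk_hessian_path hu₀.1 hu₁.1] at this
    · intro t ht
      have := (hpath t ht).2 y
      unfold Mmat at this
      rwa [hk_hessian_path hu₀.1 hu₁.1] at this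
  have hIntg : ∀ t ∈ Set.Icc (0:ℝ) 1, IntegrableOn (fun y =>
      -(1/2) * Real.log (hessian n (fun y => (1 - t) * u₀ y + t * u₁ y) y).det +
        (1/2) * rhoFn (hkM (ξ y) (hessian n (fun y => (1 - t) * u₀ y + t * u₁ y) y)))
      (Set.pi Set.univ (fun _ : Fin n => Set.Icc (0:ℝ) 1)) := fun t ht =>
    hk_integrable hξc (hk_hessian_cont (hpath t ht).1.1) hξsym (hpath t ht).1.2.2 (hpath t ht).2
  refine ⟨convex_Icc 0 1, ?_⟩
  intro t1 ht1 t2 ht2 a b ha hb hab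
  have ht3 := (convex_Icc (0:ℝ) 1) ht1 ht2 ha hb hab
  have i1 := hIntg t1 ht1
  have i2 := hIntg t2 ht2
  have i3 := hIntg _ ht3
  simp only [smul_eq_mul] at *
  have hM : ∀ u y, Mmat n ξ u y = hkM (ξ y) (hessian n u y) := fun _ _ => rfl
  simp only [Fhat, hM]
  rw [← integral_const_mul, ← integral_const_mul,
    ← integral_add (Integrable.const_mul i1 a) (Integrable.const_mul i2 b)]
  refine integral_mono i3 ((Integrable.const_mul i1 a).add (Integrable.const_mul i2 b)) ?_
  intro y
  exact (hpw y).2 ht1 ht2 ha hb hab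
end
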